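/- arXiv:2002.05566 — 4 statements merged into one kernel-verified Lean document; each statement's English description precedes it below -/
import Mathlib

section
/- A linear system of hypersurfaces of degree d in ℙᴺ defining a birational map ℙᴺ ⇢ ℙᴺ is complete modulo its fundamental (base) subscheme B; that is, it coincides with the linear system of all degree-d hypersurfaces containing B. -/
/-!
STATEMENT 9: A linear system of hypersurfaces of degree `d` in `ℙᴺ` defining a
birational map `ℙᴺ ⇢ ℙᴺ` is complete modulo its fundamental (base) subscheme `B`.
The linear system is spanned by `N+1` linearly independent homogeneous forms
`F₀, …, F_N` of degree `d`; birationality means the induced map is (projectively)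
injective on a nonempty Zariski-open subset.  A degree-`d` hypersurface `G` contains
the base subscheme `B` iff `G` lies in the saturation of the ideal generated by the
`Fᵢ` (i.e. `Xⱼᵏ·G` lies in that ideal for some `k` and all `j`); the conclusion is that
any such `G` already belongs to the linear span of the `Fᵢ`.
-/

open MvPolynomial

open scoped TensorProduct in
theorem tmul_one_sub_one_tmul_pow_ne_zero {K L : Type*} [Field K]
    [Field L] [Algebra K L] {t : L} {n : ℕ}
    (ht : LinearIndependent K fun i : Fin (n + 1) ↦ t ^ (i : ℕ)) :
    (t ⊗ₜ[K] (1 : L) - 1 ⊗ₜ t) ^ n ≠ 0 := by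
  intro h
  have hli := ht.tmul_of_flat_left ht
  rw [Fintype.linearIndependent_iff] at hli
  rw [sub_eq_add_neg, (Commute.all _ _).add_pow, Finset.sum_range] at h
  have := hli (fun p ↦ if (p.1 : ℕ) + p.2 = n then (-1) ^ (p.2 : ℕ) * (n.choose p.1 : K) else 0) ?_
    (Fin.last n, 0)
  · simp at this
  · rw [Fintype.sum_prod_type, ← h]
    refine Finset.sum_congr rfl fun i _ ↦ ?_
    rw [Finset.sum_eq_single (Fin.rev i)]
    · have hi : (i : ℕ) + (Fin.rev i : ℕ) = n := by simp [Fin.val_rev]; omega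
      have hr : (Fin.rev i : ℕ) = n - i := by omega
      simp only [hi, if_true]
      have hmul : (t ^ (i : ℕ)) ⊗ₜ[K] (t ^ (n - i)) =
          (t ⊗ₜ[K] (1 : L)) ^ (i : ℕ) * ((1 : L) ⊗ₜ[K] t) ^ (n - i) := by
        simp [Algebra.TensorProduct.tmul_pow]
      rw [hr, neg_pow ((1 : L) ⊗ₜ[K] t), hmul, Algebra.smul_def, map_mul, map_pow, map_neg, map_one,
        map_natCast]
      ring
    · intro j _ hj
      rw [if_neg, zero_smul]
      contrapose! hj
      ext
      rw [Fin.val_rev]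
      dsimp only at hj
      omega
    · simp

open scoped TensorProduct in
theorem map_tmul_one_sub_one_tmul_eq_zero_of_isNilpotent {K E L : Type*} [Field K] [Field E]
    [Field L] [Algebra K E] [Algebra K L] [IsReduced (E ⊗[K] E)] (φ : E →ₐ[K] L) (g : E)
    (h : IsNilpotent (φ g ⊗ₜ[K] (1 : L) - 1 ⊗ₜ φ g)) : φ g ⊗ₜ[K] (1 : L) - 1 ⊗ₜ φ g = 0 := by
  let ψ : E ⊗[K] E →ₐ[K] L ⊗[K] L := Algebra.TensorProduct.map φ φ
  have hψ : Function.Injective ψ :=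
    TensorProduct.map_injective_of_flat_flat _ _ φ.injective φ.injective
  have hg : ψ (g ⊗ₜ[K] (1 : E) - 1 ⊗ₜ g) = φ g ⊗ₜ[K] (1 : L) - 1 ⊗ₜ φ g := by simp [ψ]
  rw [← hg] at h ⊢
  rw [((IsNilpotent.map_iff hψ).1 h).eq_zero, map_zero]

open scoped TensorProduct in
theorem not_isNilpotent_tmul_one_sub_one_tmul {K L : Type*} [Field K] [CharZero K]
    [Field L] [Algebra K L] {t : L} (ht : t ∉ (⊥ : IntermediateField K L)) :
    ¬ IsNilpotent (t ⊗ₜ[K] (1 : L) - 1 ⊗ₜ t) := by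
  by_cases hint : IsIntegral K t
  · let E := IntermediateField.adjoin K {t}
    have : FiniteDimensional K E := IntermediateField.adjoin.finiteDimensional hint
    have : Algebra.FormallyUnramified K E := .of_isSeparable K E
    have : IsReduced (E ⊗[K] E) := Algebra.FormallyUnramified.isReduced_of_field E (E ⊗[K] E)
    intro h
    have h0 : t ⊗ₜ[K] (1 : L) - 1 ⊗ₜ t = 0 :=
      map_tmul_one_sub_one_tmul_eq_zero_of_isNilpotent E.val
        (IntermediateField.AdjoinSimple.gen K t) h
    refine tmul_one_sub_one_tmul_pow_ne_zero (n := 1) (K := K) (t := t) ?_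
      (by rw [h0, zero_pow one_ne_zero])
    have : (fun i : Fin (1 + 1) ↦ t ^ (i : ℕ)) = ![1, t] := by
      ext i; fin_cases i <;> simp
    rw [this, LinearIndependent.pair_iff' one_ne_zero]
    intro a ha
    exact ht (IntermediateField.mem_bot.2 ⟨a, by rw [← ha, Algebra.smul_def, mul_one]⟩)
  · rintro ⟨n, hn⟩
    refine tmul_one_sub_one_tmul_pow_ne_zero (n := n) (K := K) (t := t) ?_ hn
    have htr : Transcendental K t := fun h ↦ hint h.isIntegral
    have hli := (Polynomial.basisMonomials K).linearIndependent.map' (Polynomial.aeval t).toLinearMap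
      (LinearMap.ker_eq_bot.2 (transcendental_iff_injective.1 htr))
    simpa [Function.comp_def] using hli.comp (fun i : Fin (n + 1) ↦ (i : ℕ)) Fin.val_injective

open scoped TensorProduct in
theorem exists_eval_eq_and_eval_mul_ne {σ ι L : Type*} [Finite σ] [Field L]
    [Algebra (MvPolynomial σ ℂ) L] [FaithfulSMul (MvPolynomial σ ℂ) L]
    [Algebra ℂ L] [IsScalarTower ℂ (MvPolynomial σ ℂ) L]
    (F : ι → MvPolynomial σ ℂ) {u v w : MvPolynomial σ ℂ} (hv : v ≠ 0) (hw : w ≠ 0)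
    (huv : algebraMap _ L u / algebraMap _ L v ∉
      IntermediateField.adjoin ℂ (Set.range fun i ↦ algebraMap _ L (F i))) :
    ∃ x y : σ → ℂ, (∀ i, eval x (F i) = eval y (F i)) ∧ eval x w ≠ 0 ∧ eval y w ≠ 0 ∧
      eval x u * eval y v ≠ eval x v * eval y u := by
  set K := IntermediateField.adjoin ℂ (Set.range fun i ↦ algebraMap _ L (F i))
  set t := algebraMap _ L u / algebraMap _ L v
  have ht : t ∉ (⊥ : IntermediateField K L) := by
    rintro h
    obtain ⟨a, ha⟩ := IntermediateField.mem_bot.1 h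
    exact huv (ha ▸ a.2)
  have hnil := not_isNilpotent_tmul_one_sub_one_tmul ht
  let T := L ⊗[K] L
  obtain ⟨P, hP, hPt⟩ : ∃ P : Ideal T, P.IsPrime ∧ (t ⊗ₜ[K] (1 : L) - 1 ⊗ₜ t) ∉ P := by
    rw [← mem_nilradical, nilradical_eq_sInf, Submodule.mem_sInf] at hnil
    push Not at hnil
    exact hnil
  let l : MvPolynomial σ ℂ →ₐ[ℂ] T :=
    (Algebra.TensorProduct.includeLeft : L →ₐ[ℂ] T).comp (IsScalarTower.toAlgHom ℂ _ L)
  let r : MvPolynomial σ ℂ →ₐ[ℂ] T :=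
    ((Algebra.TensorProduct.includeRight : L →ₐ[K] T).restrictScalars ℂ).comp
      (IsScalarTower.toAlgHom ℂ _ L)
  let Φ : MvPolynomial (σ ⊕ σ) ℂ →ₐ[ℂ] T := aeval (Sum.elim (fun i ↦ l (X i)) fun i ↦ r (X i))
  have hl (p) : Φ (rename Sum.inl p) = l p := by
    have : Φ.comp (rename Sum.inl) = l := by ext; simp [Φ]
    rw [← this]; rfl
  have hr (p) : Φ (rename Sum.inr p) = r p := by
    have : Φ.comp (rename Sum.inr) = r := by ext; simp [Φ]
    rw [← this]; rfl
  have hlu (p) (hp : p ≠ 0) : IsUnit (l p) :=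
    (IsUnit.mk0 (algebraMap _ L p) (by simpa using hp)).map
      (Algebra.TensorProduct.includeLeft : L →ₐ[ℂ] T)
  have hru (p) (hp : p ≠ 0) : IsUnit (r p) :=
    (IsUnit.mk0 (algebraMap _ L p) (by simpa using hp)).map
      (Algebra.TensorProduct.includeRight : L →ₐ[K] T)
  have hlr (i) : l (F i) = r (F i) :=
    Algebra.TensorProduct.tmul_one_eq_one_tmul (A := L) (B := L)
      (⟨algebraMap _ L (F i), IntermediateField.subset_adjoin _ _ ⟨i, rfl⟩⟩ : K)
  have hsub : l u * r v - l v * r u = l v * r v * (t ⊗ₜ[K] (1 : L) - 1 ⊗ₜ t) := by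
    have hu : algebraMap _ L u = algebraMap _ L v * t := by
      rw [mul_div_cancel₀]; simpa using hv
    have hl' (p) : l p = algebraMap _ L p ⊗ₜ[K] (1 : L) := rfl
    have hr' (p) : r p = (1 : L) ⊗ₜ[K] algebraMap _ L p := rfl
    rw [hl', hl', hr', hr', hu]
    have hm₁ : (algebraMap _ L v * t) ⊗ₜ[K] (1 : L) = algebraMap _ L v ⊗ₜ[K] (1 : L) * t ⊗ₜ[K] 1 := by
      simp
    have hm₂ : (1 : L) ⊗ₜ[K] (algebraMap _ L v * t) = (1 : L) ⊗ₜ[K] algebraMap _ L v * 1 ⊗ₜ[K] t := by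
      simp
    rw [hm₁, hm₂]
    ring
  let h : MvPolynomial (σ ⊕ σ) ℂ := rename Sum.inl w * rename Sum.inr w *
    (rename Sum.inl u * rename Sum.inr v - rename Sum.inl v * rename Sum.inr u)
  have hΦ : h ∉ P.comap Φ := by
    rw [Ideal.mem_comap]
    simp only [h, map_mul, map_sub, hl, hr, hsub]
    rw [← mul_assoc, Ideal.unit_mul_mem_iff_mem]
    · exact hPt
    · exact ((hlu w hw).mul (hru w hw)).mul ((hlu v hv).mul (hru v hv))
  have : (P.comap Φ).IsPrime := Ideal.comap_isPrime _ _
  rw [← IsPrime.vanishingIdeal_zeroLocus (k := ℂ) (K := ℂ) (P.comap Φ), mem_vanishingIdeal_iff] at hΦ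
  push Not at hΦ
  obtain ⟨z, hz, hzh⟩ := hΦ
  have hzl (p : MvPolynomial σ ℂ) : aeval z (rename Sum.inl p) = eval (fun i ↦ z (.inl i)) p := by
    rw [aeval_rename]; rfl
  have hzr (p : MvPolynomial σ ℂ) : aeval z (rename Sum.inr p) = eval (fun i ↦ z (.inr i)) p := by
    rw [aeval_rename]; rfl
  simp only [h, map_mul, map_sub, hzl, hzr, mul_ne_zero_iff, sub_ne_zero] at hzh
  refine ⟨fun i ↦ z (.inl i), fun i ↦ z (.inr i), fun i ↦ ?_, hzh.1.1, hzh.1.2, hzh.2⟩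
  rw [← hzl, ← hzr, ← sub_eq_zero, ← map_sub]
  refine mem_zeroLocus_iff.1 hz _ ?_
  rw [Ideal.mem_comap, map_sub, hl, hr, hlr, sub_self]
  exact P.zero_mem

theorem MvPolynomial.homogeneousComponent_add_mul_of_isHomogeneous {σ R : Type*} [CommSemiring R]
    {F : MvPolynomial σ R} {d : ℕ} (hF : F.IsHomogeneous d) (c : MvPolynomial σ R) (e : ℕ) :
    homogeneousComponent (e + d) (c * F) = homogeneousComponent e c * F := by
  have hk (k : ℕ) : homogeneousComponent (e + d) (homogeneousComponent k c * F) =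
      if k = e then homogeneousComponent k c * F else 0 := by
    rw [homogeneousComponent_of_mem ((homogeneousComponent_isHomogeneous k c).mul hF)]
    simp [eq_comm]
  conv_lhs => rw [← sum_homogeneousComponent c, Finset.sum_mul, map_sum]
  simp only [hk, Finset.sum_ite_eq', Finset.mem_range]
  split_ifs with h
  · rfl
  · rw [homogeneousComponent_eq_zero _ _ (by omega), zero_mul]

theorem MvPolynomial.isIntegral_of_X_pow_mul_mem_span {σ ι k : Type*} [Fintype σ] [Nonempty σ]
    [Finite ι] [Field k] {F : ι → MvPolynomial σ k} {d : ℕ} (hF : ∀ i, (F i).IsHomogeneous d)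
    {G : MvPolynomial σ k} (hG : G.IsHomogeneous d) {n : ℕ}
    (h : ∀ j, X j ^ n * G ∈ Ideal.span (Set.range F)) :
    IsIntegral (Algebra.adjoin k (Set.range F)) G := by
  set A := Algebra.adjoin k (Set.range F)
  set e := Fintype.card σ * n
  have : Fintype ι := Fintype.ofFinite ι
  obtain ⟨B, hB⟩ := homogeneousSubmodule_fg (σ := σ) (R := k) e
  have hBA {p : MvPolynomial σ k} (hp : p.IsHomogeneous e) :
      p ∈ Submodule.span A (B : Set (MvPolynomial σ k)) := by
    have : p ∈ Submodule.span k (B : Set (MvPolynomial σ k)) := by rwa [hB]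
    exact Submodule.span_le_restrictScalars k A _ this
  have key (m : σ →₀ ℕ) (hm : m.degree = e) :
      G * monomial m 1 ∈ Submodule.span A (B : Set (MvPolynomial σ k)) := by
    obtain ⟨j, hj⟩ : ∃ j, n ≤ m j := by
      by_contra! hlt
      have := Finset.sum_lt_sum_of_nonempty (Finset.univ_nonempty (α := σ)) fun j _ ↦ hlt j
      rw [← Finsupp.degree_eq_sum, hm] at this
      simp [e] at this
    have hmem : monomial m 1 * G ∈ Ideal.span (Set.range F) := by
      have : (monomial m 1 : MvPolynomial σ k) =
          monomial (m - Finsupp.single j n) 1 * X j ^ n := by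
        rw [X_pow_eq_monomial, monomial_mul, one_mul, tsub_add_cancel_of_le]
        simpa using hj
      rw [this, mul_assoc]
      exact Ideal.mul_mem_left _ _ (h j)
    obtain ⟨c, hc⟩ := Ideal.mem_span_range_iff_exists_fun.1 hmem
    have hhom : homogeneousComponent (e + d) (monomial m 1 * G) = monomial m 1 * G :=
      homogeneousComponent_eq_self ((isHomogeneous_monomial _ hm).mul hG)
    rw [mul_comm, ← hhom, ← hc, map_sum]
    refine Submodule.sum_mem _ fun i _ ↦ ?_
    rw [homogeneousComponent_add_mul_of_isHomogeneous (hF i), mul_comm]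
    exact Submodule.smul_mem _ (⟨F i, Algebra.subset_adjoin ⟨i, rfl⟩⟩ : A)
      (hBA (homogeneousComponent_isHomogeneous _ _))
  refine isIntegral_of_smul_mem_submodule (Submodule.span A (B : Set (MvPolynomial σ k))) ?_
    ⟨B, rfl⟩ G fun p hp ↦ ?_
  · obtain ⟨j⟩ := ‹Nonempty σ›
    refine (Submodule.ne_bot_iff _).2 ⟨_, hBA (isHomogeneous_X_pow (R := k) j e), ?_⟩
    exact pow_ne_zero _ (X_ne_zero j)
  · induction hp using Submodule.span_induction with
    | mem p hp =>
      have hp : p ∈ homogeneousSubmodule σ k e := hB ▸ Submodule.subset_span hp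
      rw [smul_eq_mul, ← support_sum_monomial_coeff p, Finset.mul_sum]
      refine Submodule.sum_mem _ fun m hm ↦ ?_
      have hdeg : m.degree = e := by
        by_contra hne
        exact (mem_support_iff.1 hm) (IsHomogeneous.coeff_eq_zero hp hne)
      have : G * monomial m (coeff m p) = coeff m p • (G * monomial m 1) := by
        rw [← mul_smul_comm, smul_monomial, smul_eq_mul, mul_one]
      rw [this]
      exact Submodule.smul_of_tower_mem _ _ (key m hdeg)
    | zero => simp
    | add p q _ _ hp hq => rw [smul_add]; exact add_mem hp hq
    | smul a p _ hp => rw [smul_comm]; exact Submodule.smul_mem _ _ hp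

theorem MvPolynomial.mem_span_of_mem_adjoin {σ ι k : Type*} [Field k]
    {F : ι → MvPolynomial σ k} {d : ℕ} (hd : 0 < d) (hF : ∀ i, (F i).IsHomogeneous d)
    {G : MvPolynomial σ k} (hG : G.IsHomogeneous d)
    (h : G ∈ Algebra.adjoin k (Set.range F)) : G ∈ Submodule.span k (Set.range F) := by
  rw [Algebra.adjoin_range_eq_range_aeval] at h
  obtain ⟨p, rfl⟩ := h
  change aeval F p ∈ _
  have hsum : aeval F p = ∑ m ∈ p.support, aeval F (monomial m (coeff m p)) := by
    rw [← map_sum, support_sum_monomial_coeff]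
  rw [← homogeneousComponent_eq_self (p := aeval F p) hG, hsum, map_sum]
  refine Submodule.sum_mem _ fun m _ ↦ ?_
  have hm : (aeval F (monomial m (coeff m p))).IsHomogeneous (d * m.degree) :=
    (isHomogeneous_monomial _ rfl).aeval F hF
  rw [homogeneousComponent_of_mem hm]
  split_ifs with h1
  · have : m.degree = 1 := by
      refine Nat.eq_of_mul_eq_mul_left hd ?_
      omega
    obtain ⟨i, rfl⟩ : m ∈ Set.range fun i : ι ↦ Finsupp.single i 1 := by
      rwa [Finsupp.range_single_one]
    rw [aeval_monomial]
    simp only [Finsupp.prod_single_index, pow_one, pow_zero]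
    rw [← Algebra.smul_def]
    exact Submodule.smul_mem _ _ (Submodule.subset_span ⟨i, rfl⟩)
  · exact zero_mem _

theorem MvPolynomial.algebraMap_eq_pow_mul_aeval_div_of_isHomogeneous {σ k L : Type*} [Field k]
    [Field L] [Algebra (MvPolynomial σ k) L] [FaithfulSMul (MvPolynomial σ k) L] [Algebra k L]
    [IsScalarTower k (MvPolynomial σ k) L] {p : MvPolynomial σ k} {d : ℕ}
    (hp : p.IsHomogeneous d) (j : σ) :
    algebraMap _ L p = algebraMap _ L (X j : MvPolynomial σ k) ^ d *
      aeval (fun i ↦ algebraMap _ L (X i : MvPolynomial σ k) /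
        algebraMap _ L (X j : MvPolynomial σ k)) p := by
  have hj : algebraMap _ L (X j : MvPolynomial σ k) ≠ 0 := by simp
  have h (q : MvPolynomial σ k) :
      algebraMap _ L q = aeval (fun i ↦ algebraMap _ L (X i : MvPolynomial σ k)) q := by
    rw [← IsScalarTower.coe_toAlgHom' k (MvPolynomial σ k) L]
    exact DFunLike.congr_fun (by ext; simp) q
  rw [h p, aeval_def, aeval_def, eval₂_eq, eval₂_eq, Finset.mul_sum]
  refine Finset.sum_congr rfl fun m hm ↦ ?_
  have hdeg : d = ∑ i ∈ m.support, m i := hp.degree_eq_sum_deg_support hm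
  rw [mul_left_comm, hdeg, ← Finset.prod_pow_eq_pow_sum, ← Finset.prod_mul_distrib]
  congr 1
  refine Finset.prod_congr rfl fun i _ ↦ ?_
  rw [← mul_pow, mul_div_cancel₀ _ hj]

theorem MvPolynomial.isAlgebraic_adjoin_of_X_div_X_mem_adjoin {σ ι k L : Type*}
    [Field k] [Field L] [Algebra (MvPolynomial σ k) L] [IsFractionRing (MvPolynomial σ k) L]
    [Algebra k L] [IsScalarTower k (MvPolynomial σ k) L] {F : ι → MvPolynomial σ k} {d : ℕ}
    (hd : 0 < d) (hF : ∀ i, (F i).IsHomogeneous d) {j : σ} {l : ι} (hl : F l ≠ 0)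
    (h : ∀ i, algebraMap _ L (X i : MvPolynomial σ k) / algebraMap _ L (X j : MvPolynomial σ k) ∈
      IntermediateField.adjoin k (Set.range fun i ↦ algebraMap _ L (F i))) :
    Algebra.IsAlgebraic
      (IntermediateField.adjoin k (Set.range fun i ↦ algebraMap _ L (F i))) L := by
  have hinj := IsFractionRing.injective (MvPolynomial σ k) L
  have : FaithfulSMul (MvPolynomial σ k) L := (faithfulSMul_iff_algebraMap_injective _ _).2 hinj
  set K := IntermediateField.adjoin k (Set.range fun i ↦ algebraMap _ L (F i))
  have hFK (i) : algebraMap _ L (F i) ∈ K := IntermediateField.subset_adjoin _ _ ⟨i, rfl⟩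
  have hj : IsAlgebraic K (algebraMap _ L (X j : MvPolynomial σ k)) := by
    have hpow : algebraMap _ L (X j : MvPolynomial σ k) ^ d ∈ K := by
      have heq := algebraMap_eq_pow_mul_aeval_div_of_isHomogeneous (L := L) (hF l) j
      set c := aeval (fun i ↦ algebraMap _ L (X i : MvPolynomial σ k) /
        algebraMap _ L (X j : MvPolynomial σ k)) (F l)
      have hc : c ∈ K := by
        have : c ∈ (aeval (R := k) fun i ↦ algebraMap _ L (X i : MvPolynomial σ k) /
            algebraMap _ L (X j : MvPolynomial σ k)).range := ⟨_, rfl⟩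
        rw [← Algebra.adjoin_range_eq_range_aeval] at this
        have hle : Algebra.adjoin k (Set.range fun i ↦ algebraMap _ L (X i : MvPolynomial σ k) /
            algebraMap _ L (X j : MvPolynomial σ k)) ≤ K.toSubalgebra :=
          Algebra.adjoin_le (by rintro _ ⟨i, rfl⟩; exact h i)
        exact hle this
      have hc0 : c ≠ 0 := by
        rintro hc0
        rw [hc0, mul_zero] at heq
        exact hl (hinj (heq.trans (map_zero _).symm))
      rw [show algebraMap _ L (X j : MvPolynomial σ k) ^ d = algebraMap _ L (F l) / c from
        eq_div_of_mul_eq hc0 heq.symm]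
      exact div_mem (hFK l) hc
    exact (isAlgebraic_algebraMap (⟨_, hpow⟩ : K)).of_pow hd
  have hX (i) : IsAlgebraic K (algebraMap _ L (X i : MvPolynomial σ k)) := by
    have hj0 : algebraMap _ L (X j : MvPolynomial σ k) ≠ 0 := by simp
    rw [← div_mul_cancel₀ (algebraMap _ L (X i : MvPolynomial σ k)) hj0]
    exact (isAlgebraic_algebraMap (⟨_, h i⟩ : K)).mul hj
  have hpoly (p : MvPolynomial σ k) : IsAlgebraic K (algebraMap _ L p) := by
    induction p using MvPolynomial.induction_on with
    | C a =>
      rw [← algebraMap_eq, ← IsScalarTower.algebraMap_apply, IsScalarTower.algebraMap_apply k K L]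
      exact isAlgebraic_algebraMap _
    | add p q hp hq => rw [map_add]; exact hp.add hq
    | mul_X p i hp => rw [map_mul]; exact hp.mul (hX i)
  refine ⟨fun z ↦ ?_⟩
  obtain ⟨a, b, _, rfl⟩ := IsFractionRing.div_surjective (A := MvPolynomial σ k) z
  rw [div_eq_mul_inv]
  exact (hpoly a).mul (hpoly b).inv

open scoped IntermediateField.algebraAdjoinAdjoin in
theorem isAlgebraic_algebraAdjoin {k L : Type*} [Field k] [Field L] [Algebra k L] (S : Set L)
    (halg : Algebra.IsAlgebraic (IntermediateField.adjoin k S) L) :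
    Algebra.IsAlgebraic (Algebra.adjoin k S) L :=
  (IsFractionRing.comap_isAlgebraic_iff (K := IntermediateField.adjoin k S)).2 halg

theorem MvPolynomial.algebraicIndependent_of_isAlgebraic_adjoin {σ k L : Type*} [Finite σ]
    [Field k] [Field L] [Algebra (MvPolynomial σ k) L] [FaithfulSMul (MvPolynomial σ k) L]
    [Algebra k L] [IsScalarTower k (MvPolynomial σ k) L] {F : σ → MvPolynomial σ k}
    (halg : Algebra.IsAlgebraic
      (IntermediateField.adjoin k (Set.range fun i ↦ algebraMap _ L (F i))) L) :
    AlgebraicIndependent k F := by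
  have hinj := FaithfulSMul.algebraMap_injective (MvPolynomial σ k) L
  have halg' := isAlgebraic_algebraAdjoin _ halg
  have hXL : AlgebraicIndependent k fun i ↦ algebraMap _ L (X i : MvPolynomial σ k) :=
    (algebraicIndependent_X σ k).map' (f := IsScalarTower.toAlgHom k _ L) hinj
  have hFL : AlgebraicIndependent k fun i ↦ algebraMap _ L (F i) :=
    (Algebra.IsAlgebraic.isTranscendenceBasis_of_lift_le_trdeg_of_finite k _
      hXL.lift_cardinalMk_le_trdeg).1
  exact AlgebraicIndependent.of_comp (IsScalarTower.toAlgHom k (MvPolynomial σ k) L) hFL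

theorem MvPolynomial.mem_adjoin_of_isIntegral_of_mem_adjoin {σ ι k L : Type*}
    [Field k] [Field L] [Algebra (MvPolynomial σ k) L] [FaithfulSMul (MvPolynomial σ k) L]
    [Algebra k L] [IsScalarTower k (MvPolynomial σ k) L] {F : ι → MvPolynomial σ k}
    (hF : AlgebraicIndependent k F) {G : MvPolynomial σ k}
    (hint : IsIntegral (Algebra.adjoin k (Set.range F)) G)
    (hG : algebraMap _ L G ∈
      IntermediateField.adjoin k (Set.range fun i ↦ algebraMap _ L (F i))) :
    G ∈ Algebra.adjoin k (Set.range F) := by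
  have hinj := FaithfulSMul.algebraMap_injective (MvPolynomial σ k) L
  have hFL : AlgebraicIndependent k fun i ↦ algebraMap _ L (F i) :=
    hF.map' (f := IsScalarTower.toAlgHom k _ L) hinj
  set A := Algebra.adjoin k (Set.range F)
  set K := IntermediateField.adjoin k (Set.range fun i ↦ algebraMap _ L (F i))
  have hmap : A.map (IsScalarTower.toAlgHom k _ L) =
      Algebra.adjoin k (Set.range fun i ↦ algebraMap _ L (F i)) := by
    rw [AlgHom.map_adjoin, ← Set.range_comp]; rfl
  set AL := Algebra.adjoin k (Set.range fun i ↦ algebraMap _ L (F i))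
  have : IsIntegrallyClosed AL := .of_equiv hFL.aevalEquiv.toRingEquiv
  let φ : A →+* AL := ((algebraMap _ L).comp A.val.toRingHom).codRestrict AL fun a ↦ by
    rw [← hmap]; exact ⟨a, a.2, rfl⟩
  have hint' : IsIntegral AL (algebraMap _ L G) := hint.map_of_comp_eq φ (algebraMap _ L) rfl
  open scoped IntermediateField.algebraAdjoinAdjoin in
  have hintK : IsIntegral AL (⟨_, hG⟩ : K) :=
    (isIntegral_algHom_iff (IsScalarTower.toAlgHom AL K L) (algebraMap K L).injective).1 hint'
  open scoped IntermediateField.algebraAdjoinAdjoin in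
  obtain ⟨y, hy⟩ := IsIntegrallyClosed.algebraMap_eq_of_integral hintK
  have hyG : (y : L) = algebraMap _ L G := congrArg Subtype.val hy
  have hy2 := y.2
  rw [hyG, ← hmap] at hy2
  obtain ⟨a, ha, haG⟩ := hy2
  rwa [← hinj haG]

theorem MvPolynomial.eval_smul_of_isHomogeneous {σ R : Type*} [CommSemiring R]
    {p : MvPolynomial σ R} {d : ℕ} (hp : p.IsHomogeneous d) (c : R) (x : σ → R) :
    eval (c • x) p = c ^ d * eval x p := by
  rw [eval_eq, eval_eq, Finset.mul_sum]
  refine Finset.sum_congr rfl fun m hm ↦ ?_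
  have hdeg : d = ∑ i ∈ m.support, m i := hp.degree_eq_sum_deg_support hm
  rw [mul_left_comm, hdeg, ← Finset.prod_pow_eq_pow_sum, ← Finset.prod_mul_distrib]
  simp only [Pi.smul_apply, smul_eq_mul, mul_pow]

theorem stmt9 {N d : ℕ} (hd : 0 < d)
    (F : Fin (N + 1) → MvPolynomial (Fin (N + 1)) ℂ)
    (hFhom : ∀ i, (F i).IsHomogeneous d)
    (hFind : LinearIndependent ℂ F)
    -- birationality: generically (projectively) injective
    (hbir : ∃ q : MvPolynomial (Fin (N + 1)) ℂ, q ≠ 0 ∧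
      ∀ x y : Fin (N + 1) → ℂ, eval x q ≠ 0 → eval y q ≠ 0 →
        (∃ c : ℂ, c ≠ 0 ∧ ∀ i, eval y (F i) = c * eval x (F i)) →
        ∃ c : ℂ, c ≠ 0 ∧ y = c • x) :
    ∀ G : MvPolynomial (Fin (N + 1)) ℂ, G.IsHomogeneous d →
      (∃ k : ℕ, ∀ j : Fin (N + 1), (X j) ^ k * G ∈ Ideal.span (Set.range F)) →
      G ∈ Submodule.span ℂ (Set.range F) := by
  intro G hG ⟨k, hk⟩
  obtain ⟨q, hq, hinj⟩ := hbir
  let L := FractionRing (MvPolynomial (Fin (N + 1)) ℂ)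
  have hF0 : F 0 ≠ 0 := hFind.ne_zero 0
  have hfib {x y : Fin (N + 1) → ℂ} (hF : ∀ i, eval x (F i) = eval y (F i))
      (hx : eval x (q * F 0) ≠ 0) (hy : eval y (q * F 0) ≠ 0) : ∃ c : ℂ, c ^ d = 1 ∧ y = c • x := by
    rw [map_mul, mul_ne_zero_iff] at hx hy
    obtain ⟨c, -, rfl⟩ := hinj x y hx.1 hy.1 ⟨1, one_ne_zero, fun i ↦ by rw [one_mul, hF]⟩
    refine ⟨c, ?_, rfl⟩
    have := hF 0
    rw [eval_smul_of_isHomogeneous (hFhom 0)] at this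
    exact mul_right_cancel₀ hx.2 (by rw [one_mul, ← this])
  have hX (i) : algebraMap _ L (X i : MvPolynomial (Fin (N + 1)) ℂ) /
      algebraMap _ L (X 0 : MvPolynomial (Fin (N + 1)) ℂ) ∈
      IntermediateField.adjoin ℂ (Set.range fun i ↦ algebraMap _ L (F i)) := by
    by_contra hi
    obtain ⟨x, y, hxy, hx, hy, hne⟩ :=
      exists_eval_eq_and_eval_mul_ne F (X_ne_zero 0) (mul_ne_zero hq hF0) hi
    obtain ⟨c, -, rfl⟩ := hfib hxy hx hy
    refine hne ?_
    simp only [eval_X, Pi.smul_apply, smul_eq_mul]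
    ring
  have hGK : algebraMap _ L G ∈
      IntermediateField.adjoin ℂ (Set.range fun i ↦ algebraMap _ L (F i)) := by
    by_contra hi
    rw [← div_one (algebraMap _ L G), ← map_one (algebraMap (MvPolynomial (Fin (N + 1)) ℂ) L)] at hi
    obtain ⟨x, y, hxy, hx, hy, hne⟩ :=
      exists_eval_eq_and_eval_mul_ne F one_ne_zero (mul_ne_zero hq hF0) hi
    obtain ⟨c, hc, rfl⟩ := hfib hxy hx hy
    refine hne ?_
    rw [eval_smul_of_isHomogeneous hG, hc]
    simp
  exact mem_span_of_mem_adjoin hd hFhom hG (mem_adjoin_of_isIntegral_of_mem_adjoin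
    (algebraicIndependent_of_isAlgebraic_adjoin
      (isAlgebraic_adjoin_of_X_div_X_mem_adjoin hd hFhom hF0 hX))
    (isIntegral_of_X_pow_mul_mem_span hFhom hG hk) hGK)
end

section
/- Suppose the fundamental subscheme B of a linear system of hypersurfaces of degree d in ℙᴺ defining a birational map φ : ℙᴺ ⇢ ℙᴺ is contained in a hypersurface of degree strictly less than d. Then the linear system has a fixed component of degree d−1, the residual system is the complete linear system of hyperplanes, and φ is a linear automorphism of ℙᴺ. -/
/-!
STATEMENT 10: If the base subscheme `B` of a linear system of degree-`d` hypersurfaces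
in `ℙᴺ` defining a birational map `φ : ℙᴺ ⇢ ℙᴺ` is contained in a hypersurface of
degree `d' < d`, then the system has a fixed component of degree `d − 1`, the residual
system is the complete system of hyperplanes, and `φ` is a linear automorphism.
Setup as in Statement 9; scheme-theoretic containment `B ⊆ {H = 0}` is membership of
`H` in the saturation of the ideal generated by the system.  The conclusion produces a
homogeneous form `H'` of degree `d − 1` and linear forms `Lᵢ` with `Fᵢ = H'·Lᵢ`, the
`Lᵢ` being linearly independent (i.e. they form a complete system of hyperplanes,
so `φ` is the linear automorphism given by the `Lᵢ`).
-/

open MvPolynomial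

/-- An element that is integral over an integrally closed domain of characteristic zero and is not
moved by any conjugation already lies in the base. -/
theorem mem_range_algebraMap_of_forall_ringHom_eq {A R : Type*} [CommRing A] [IsDomain A]
    [CharZero A] [IsIntegrallyClosed A] [CommRing R] [IsDomain R] [Algebra A R] [FaithfulSMul A R]
    [Algebra.IsAlgebraic A R] {g : R} (hg : IsIntegral A g)
    (h : ∀ σ τ : R →+* AlgebraicClosure (FractionRing R), Function.Injective σ →
      Function.Injective τ → (∀ a, σ (algebraMap A R a) = τ (algebraMap A R a)) → σ g = τ g) :
    g ∈ Set.range (algebraMap A R) := by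
  let Ω := AlgebraicClosure (FractionRing R)
  have hRΩ : Function.Injective (algebraMap R Ω) := by
    rw [IsScalarTower.algebraMap_eq R (FractionRing R) Ω]
    exact (algebraMap (FractionRing R) Ω).injective.comp (IsFractionRing.injective _ _)
  have : FaithfulSMul A Ω := (faithfulSMul_iff_algebraMap_injective A Ω).mpr <| by
    rw [IsScalarTower.algebraMap_eq A R Ω]
    exact hRΩ.comp (FaithfulSMul.algebraMap_injective A R)
  let := FractionRing.liftAlgebra A Ω
  have := FractionRing.isScalarTower_liftAlgebra A Ω
  have : Algebra.IsAlgebraic R Ω :=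
    (IsFractionRing.comap_isAlgebraic_iff (K := FractionRing R)).mpr inferInstance
  have : Algebra.IsAlgebraic A Ω := Algebra.IsAlgebraic.trans A R Ω
  have : Algebra.IsAlgebraic (FractionRing A) Ω :=
    IsFractionRing.comap_isAlgebraic_iff.mp this
  have : CharZero (FractionRing A) := charZero_of_injective_algebraMap
    (FaithfulSMul.algebraMap_injective A (FractionRing A))
  have : IsAlgClosure (FractionRing A) Ω := ⟨inferInstance, inferInstance⟩
  have : IsGalois (FractionRing A) Ω := IsAlgClosure.isGalois _ _
  have hfix : ∀ f : Gal(Ω/FractionRing A), f (algebraMap R Ω g) = algebraMap R Ω g := fun f ↦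
    (h (algebraMap R Ω) ((f : Ω →+* Ω).comp (algebraMap R Ω)) hRΩ (f.injective.comp hRΩ) fun a ↦ by
      rw [RingHom.comp_apply, ← IsScalarTower.algebraMap_apply A R Ω]
      exact ((f.restrictScalars A).commutes a).symm).symm
  obtain ⟨z, hz⟩ := (InfiniteGalois.mem_range_algebraMap_iff_fixed _).mpr hfix
  have hint : IsIntegral A z := by
    rw [← isIntegral_algebraMap_iff (FaithfulSMul.algebraMap_injective (FractionRing A) Ω), hz]
    exact hg.algebraMap
  obtain ⟨a, rfl⟩ := IsIntegrallyClosed.isIntegral_iff.mp hint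
  refine ⟨a, hRΩ ?_⟩
  rw [← hz, ← IsScalarTower.algebraMap_apply, ← IsScalarTower.algebraMap_apply]

namespace MvPolynomial

variable {n K : Type*} [Field K]

/-- If `g` takes equal values at any two points outside `p = 0` at which every `F i` takes equal
values, then the same holds for points with values in any domain. -/
theorem ringHom_eq_of_forall_eval_eq {ι : Type*} [IsAlgClosed K] [Finite n]
    {F : ι → MvPolynomial n K} {p g : MvPolynomial n K}
    (h : ∀ x y : n → K, eval x p ≠ 0 → eval y p ≠ 0 → (∀ i, eval y (F i) = eval x (F i)) →
      eval y g = eval x g)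
    {S : Type*} [CommRing S] [IsDomain S] (σ τ : MvPolynomial n K →+* S)
    (hC : ∀ c, σ (C c) = τ (C c))    (hσ : σ p ≠ 0) (hτ : τ p ≠ 0)
    (hF : ∀ i, σ (F i) = τ (F i)) : σ g = τ g := by
  let l : MvPolynomial n K →ₐ[K] MvPolynomial (n ⊕ n) K := rename Sum.inl
  let r : MvPolynomial n K →ₐ[K] MvPolynomial (n ⊕ n) K := rename Sum.inr
  let J : Ideal (MvPolynomial (n ⊕ n) K) := Ideal.span (Set.range fun i ↦ l (F i) - r (F i))
  have hmem : (l g - r g) * (l p * r p) ∈ J.radical := by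
    rw [← vanishingIdeal_zeroLocus_eq_radical (K := K), mem_vanishingIdeal_iff]
    intro z hz
    have hl (f) : aeval z (l f) = eval (z ∘ Sum.inl) f := by
      simp [l, aeval_rename, aeval_eq_eval]
    have hr (f) : aeval z (r f) = eval (z ∘ Sum.inr) f := by
      simp [r, aeval_rename, aeval_eq_eval]
    have hFz (i) : eval (z ∘ Sum.inr) (F i) = eval (z ∘ Sum.inl) (F i) := by
      have := hz _ (Ideal.subset_span ⟨i, rfl⟩)
      rw [map_sub, hl, hr, sub_eq_zero] at this
      exact this.symm
    simp only [map_mul, map_sub, hl, hr, mul_eq_zero, sub_eq_zero]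
    by_contra! hne
    exact hne.1 (h _ _ hne.2.1 hne.2.2 hFz).symm
  let φ : MvPolynomial (n ⊕ n) K →+* S :=
    eval₂Hom (σ.comp C) (Sum.elim (fun j ↦ σ (X j)) fun j ↦ τ (X j))
  have hφl (f) : φ (l f) = σ f := by
    have : φ.comp l.toRingHom = σ := by ext <;> simp [φ, l]
    exact RingHom.congr_fun this f
  have hφr (f) : φ (r f) = τ f := by
    have : φ.comp r.toRingHom = τ := by ext <;> simp [φ, r, hC]
    exact RingHom.congr_fun this f
  have hJ : J ≤ RingHom.ker φ := by
    rw [Ideal.span_le]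
    rintro _ ⟨i, rfl⟩
    simp [RingHom.mem_ker, hφl, hφr, hF]
  have := (RingHom.ker_isPrime φ).radical_le_iff.mpr hJ hmem
  simpa [RingHom.mem_ker, hφl, hφr, hσ, hτ, sub_eq_zero] using this

theorem homogeneousComponent_add_mul_of_isHomogeneous_s10 {σ R : Type*} [CommSemiring R]
    {b : MvPolynomial σ R} {j : ℕ} (hb : b.IsHomogeneous j) (a : MvPolynomial σ R) (i : ℕ) :
    homogeneousComponent (i + j) (a * b) = homogeneousComponent i a * b := by
  let := MvPolynomial.gradedAlgebra (σ := σ) (R := R)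
  rw [← decomposition.decompose'_apply, ← decomposition.decompose'_apply]
  exact DirectSum.coe_decompose_mul_add_of_right_mem (homogeneousSubmodule σ R) hb

/-- A form of degree `d` in the saturation of the ideal generated by forms `F i` of degree `d` is
integral over the algebra generated by the `F i`. -/
theorem isIntegral_adjoin_of_X_pow_mul_mem {ι : Type*} [Finite n] [Nonempty n] [Finite ι] {d : ℕ}
    {F : ι → MvPolynomial n K} (hF : ∀ i, (F i).IsHomogeneous d) {g : MvPolynomial n K}
    (hg : g.IsHomogeneous d) {k : ℕ} (h : ∀ j, X j ^ k * g ∈ Ideal.span (Set.range F)) :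
    IsIntegral (Algebra.adjoin K (Set.range F)) g := by
  cases nonempty_fintype ι
  cases nonempty_fintype n
  let A := Algebra.adjoin K (Set.range F)
  let m := Fintype.card n * k
  let V := homogeneousSubmodule n K m
  let M : Submodule A (MvPolynomial n K) := Submodule.span A (V : Set (MvPolynomial n K))
  have hideal : ∀ a ∈ V, a * g ∈ Ideal.span (Set.range F) := by
    intro a ha
    rw [a.as_sum, Finset.sum_mul]
    refine Ideal.sum_mem _ fun s hs ↦ ?_
    have hdeg : ∑ j, s j = m := by
      rw [← Finsupp.degree_eq_sum]
      by_contra hne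
      exact mem_support_iff.mp hs (IsHomogeneous.coeff_eq_zero ha hne)
    obtain ⟨j, hj⟩ : ∃ j, k ≤ s j := by
      by_contra! hlt
      have := Finset.sum_lt_sum_of_nonempty Finset.univ_nonempty fun j _ ↦ hlt j
      simp [hdeg, m] at this
    obtain ⟨c, hc⟩ : X j ^ k ∣ monomial s (coeff s a) := by
      rw [X_pow_eq_monomial, monomial_dvd_monomial]
      exact ⟨Or.inr (Finsupp.single_le_iff.mpr hj), one_dvd _⟩
    rw [hc, mul_right_comm]
    exact Ideal.mul_mem_right _ _ (h j)
  have hVM : ∀ a ∈ V, g * a ∈ M := by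
    intro a ha
    obtain ⟨c, hc⟩ := Ideal.mem_span_range_iff_exists_fun.mp (hideal a ha)
    have hag : g * a = ∑ i, homogeneousComponent m (c i) * F i := by
      rw [mul_comm, ← homogeneousComponent_eq_self (IsHomogeneous.mul ha hg), ← hc, map_sum]
      exact Finset.sum_congr rfl fun i _ ↦
        homogeneousComponent_add_mul_of_isHomogeneous_s10 (hF i) (c i) m
    rw [hag]
    refine Submodule.sum_mem _ fun i _ ↦ ?_
    have hFi : F i ∈ A := Algebra.subset_adjoin ⟨i, rfl⟩
    rw [mul_comm]
    exact M.smul_mem ⟨F i, hFi⟩ (Submodule.subset_span (homogeneousComponent_mem m (c i)))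
  have hM : ∀ a ∈ M, g * a ∈ M := by
    intro a ha
    induction ha using Submodule.span_induction with
    | mem a ha => exact hVM a ha
    | zero => simp
    | add a b _ _ ha hb => rw [mul_add]; exact M.add_mem ha hb
    | smul c a _ ha => rw [mul_smul_comm]; exact M.smul_mem c ha
  have hM0 : M ≠ ⊥ := by
    intro h0
    obtain ⟨j⟩ := ‹Nonempty n›
    have : (X j ^ m : MvPolynomial n K) ∈ M := Submodule.subset_span (isHomogeneous_X_pow j m)
    rw [h0, Submodule.mem_bot] at this
    exact pow_ne_zero m (X_ne_zero j) this
  have hMfg : M.FG := by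
    obtain ⟨t, ht⟩ := homogeneousSubmodule_fg (σ := n) (R := K) m
    refine ⟨t, ?_⟩
    rw [← Submodule.span_span_of_tower K A, ht]
  exact isIntegral_of_smul_mem_submodule M hM0 hMfg g hM

theorem aeval_smul_of_isHomogeneous {σ R S : Type*} [CommSemiring R] [CommSemiring S] [Algebra R S]
    {f : MvPolynomial σ R} {d : ℕ} (hf : f.IsHomogeneous d) (c : S) (x : σ → S) :
    aeval (c • x) f = c ^ d * aeval x f := by
  rw [aeval_def, aeval_def, eval₂_eq, eval₂_eq, Finset.mul_sum]
  refine Finset.sum_congr rfl fun s hs ↦ ?_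
  have hdeg : ∑ j ∈ s.support, s j = d := by
    by_contra hne
    exact mem_support_iff.mp hs (IsHomogeneous.coeff_eq_zero hf hne)
  simp only [Pi.smul_apply, smul_eq_mul, mul_pow, Finset.prod_mul_distrib,
    Finset.prod_pow_eq_pow_sum, hdeg]
  exact mul_left_comm _ _ _

/-- If forms `F i` of positive degree are such that the products of some nonzero `p` with all
variables are integral over the algebra generated by the `F i`, then the whole polynomial ring is
algebraic over that algebra. -/
theorem isAlgebraic_adjoin_of_isAlgebraic_mul_X {ι : Type*} {d : ℕ} (hd : 0 < d)
    {F : ι → MvPolynomial n K} (hF : ∀ i, (F i).IsHomogeneous d) {i : ι} (hi : F i ≠ 0)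
    {p : MvPolynomial n K} (hp : p ≠ 0)
    (h : ∀ j, IsAlgebraic (Algebra.adjoin K (Set.range F)) (p * X j)) :
    Algebra.IsAlgebraic (Algebra.adjoin K (Set.range F)) (MvPolynomial n K) := by
  let A := Algebra.adjoin K (Set.range F)
  let B : Subalgebra A (MvPolynomial n K) := Subalgebra.algebraicClosure A (MvPolynomial n K)
  have hFB : aeval (fun j ↦ p * X j) (F i) ∈ B.restrictScalars K := by
    have hle : Algebra.adjoin K (Set.range fun j ↦ p * X j) ≤ B.restrictScalars K := by
      rw [Algebra.adjoin_le_iff]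
      rintro _ ⟨j, rfl⟩
      exact h j
    rw [Algebra.adjoin_range_eq_range_aeval] at hle
    exact hle ⟨F i, rfl⟩
  have hpow : aeval (fun j ↦ p * X j) (F i) = F i * p ^ d := by
    rw [mul_comm]
    conv_rhs => rw [← aeval_X_left_apply (F i)]
    exact aeval_smul_of_isHomogeneous (hF i) p X
  have hFi : IsAlgebraic A (F i) :=
    isAlgebraic_algebraMap (⟨F i, Algebra.subset_adjoin ⟨i, rfl⟩⟩ : A)
  have hpA : IsAlgebraic A p := by
    refine IsAlgebraic.of_pow hd (IsAlgebraic.of_mul (mem_nonZeroDivisors_of_ne_zero hi) hFi ?_)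
    rw [← hpow]
    exact hFB
  have hXB : Algebra.adjoin K (Set.range X) ≤ B.restrictScalars K := by
    rw [Algebra.adjoin_le_iff]
    rintro _ ⟨j, rfl⟩
    exact IsAlgebraic.of_mul (mem_nonZeroDivisors_of_ne_zero hp) hpA (h j)
  rw [adjoin_range_X] at hXB
  exact ⟨fun f ↦ hXB (Algebra.mem_top (x := f))⟩

/-- Forms of degree `d` lying in an algebra generated by forms of degree `d` are linear combinations
of the generators. -/
theorem mem_span_of_mem_adjoin_s10 {ι : Type*} {d : ℕ} (hd : 0 < d)
    {F : ι → MvPolynomial n K} (hF : ∀ i, (F i).IsHomogeneous d) {g : MvPolynomial n K}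
    (hg : g.IsHomogeneous d) (h : g ∈ Algebra.adjoin K (Set.range F)) :
    g ∈ Submodule.span K (Set.range F) := by
  rw [Algebra.adjoin_range_eq_range_aeval] at h
  obtain ⟨P, hP⟩ := h
  change aeval F P = g at hP
  have hcomp (m : ℕ) : homogeneousComponent d (aeval F (homogeneousComponent m P)) =
      if m = 1 then aeval F (homogeneousComponent 1 P) else 0 := by
    rw [homogeneousComponent_of_mem
      ((homogeneousComponent_isHomogeneous m P).aeval F hF)]
    by_cases hm : m = 1
    · simp [hm]
    · rw [if_neg hm, if_neg]
      rintro h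
      exact hm (Nat.eq_of_mul_eq_mul_left hd (by omega))
  have hg1 : g = aeval F (homogeneousComponent 1 P) := by
    have hsum := congrArg (fun Q ↦ homogeneousComponent d (aeval F Q)) (sum_homogeneousComponent P)
    simp only [map_sum, hcomp, hP, homogeneousComponent_eq_self hg, Finset.sum_ite_eq'] at hsum
    rw [← hsum]
    split_ifs with h1
    · rfl
    · rw [homogeneousComponent_eq_zero _ _ (by simpa [Nat.lt_iff_add_one_le] using h1), map_zero]
  have hspan : (Submodule.span K (Set.range F)) =
      (homogeneousSubmodule ι K 1).map (aeval F).toLinearMap := by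
    rw [homogeneousSubmodule_one_eq_span_X, Submodule.map_span, ← Set.range_comp]
    congr 2
    ext1 i
    simp
  rw [hspan, hg1]
  exact Submodule.mem_map_of_mem (homogeneousComponent_mem 1 P)

/-- If `p` times every variable is a linear combination of the linearly independent family `F`,
indexed by the variables, then `p` divides the family, with linear forms as quotients. -/
theorem exists_eq_mul_of_mul_X_mem_span [Finite n] {F : n → MvPolynomial n K}
    (hF : LinearIndependent K F) {p : MvPolynomial n K} (hp : p ≠ 0)
    (h : ∀ j, p * X j ∈ Submodule.span K (Set.range F)) :
    ∃ L : n → MvPolynomial n K, (∀ i, (L i).IsHomogeneous 1) ∧ (∀ i, F i = p * L i) ∧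
      LinearIndependent K L := by
  cases nonempty_fintype n
  have hX : LinearIndependent K fun j : n ↦ p * X j := by
    refine (linearIndependent_X n K).map' (LinearMap.mulLeft K p) (LinearMap.ker_eq_bot.mpr ?_)
    exact mul_right_injective₀ hp
  have hle : Submodule.span K (Set.range fun j : n ↦ p * X j) ≤ Submodule.span K (Set.range F) := by
    rw [Submodule.span_le]
    rintro _ ⟨j, rfl⟩
    exact h j
  have := FiniteDimensional.span_of_finite K (Set.finite_range F)
  have heq := Submodule.eq_of_le_of_finrank_eq hle
    (by rw [finrank_span_eq_card hX, finrank_span_eq_card hF])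
  have hmap : Submodule.span K (Set.range fun j : n ↦ p * X j) =
      (homogeneousSubmodule n K 1).map (LinearMap.mulLeft K p) := by
    rw [homogeneousSubmodule_one_eq_span_X, Submodule.map_span, ← Set.range_comp]
    rfl
  have hex (i : n) : ∃ L : MvPolynomial n K, L.IsHomogeneous 1 ∧ p * L = F i := by
    have : F i ∈ Submodule.span K (Set.range F) := Submodule.subset_span ⟨i, rfl⟩
    rw [← heq, hmap] at this
    exact this
  choose L hL hLF using hex
  refine ⟨L, hL, fun i ↦ (hLF i).symm, LinearIndependent.of_comp (LinearMap.mulLeft K p) ?_⟩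
  have hcomp : ⇑(LinearMap.mulLeft K p) ∘ L = F := _root_.funext hLF
  rw [hcomp]
  exact hF

/-- The algebra generated by algebraically independent polynomials is integrally closed. -/
theorem isIntegrallyClosed_adjoin {ι R : Type*} [CommRing R] [Algebra K R] {F : ι → R}
    (hF : AlgebraicIndependent K F) : IsIntegrallyClosed (Algebra.adjoin K (Set.range F)) :=
  .of_equiv hF.aevalEquiv.toRingEquiv

end MvPolynomial

theorem stmt10 {N d : ℕ} (hd : 0 < d)
    (F : Fin (N + 1) → MvPolynomial (Fin (N + 1)) ℂ)
    (hFhom : ∀ i, (F i).IsHomogeneous d)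
    (hFind : LinearIndependent ℂ F)
    -- birationality: generically (projectively) injective
    (hbir : ∃ q : MvPolynomial (Fin (N + 1)) ℂ, q ≠ 0 ∧
      ∀ x y : Fin (N + 1) → ℂ, eval x q ≠ 0 → eval y q ≠ 0 →
        (∃ c : ℂ, c ≠ 0 ∧ ∀ i, eval y (F i) = c * eval x (F i)) →
        ∃ c : ℂ, c ≠ 0 ∧ y = c • x)
    -- the base subscheme is contained in a hypersurface of degree d' < d
    (hB : ∃ (d' : ℕ) (H : MvPolynomial (Fin (N + 1)) ℂ), d' < d ∧ H ≠ 0 ∧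
      H.IsHomogeneous d' ∧
      ∃ k : ℕ, ∀ j : Fin (N + 1), (X j) ^ k * H ∈ Ideal.span (Set.range F)) :
    ∃ H' : MvPolynomial (Fin (N + 1)) ℂ, H'.IsHomogeneous (d - 1) ∧
      ∃ L : Fin (N + 1) → MvPolynomial (Fin (N + 1)) ℂ,
        (∀ i, (L i).IsHomogeneous 1) ∧ (∀ i, F i = H' * L i) ∧
        LinearIndependent ℂ L := by
  obtain ⟨q, hq, hinj⟩ := hbir
  obtain ⟨d', H, hd', hH, hHhom, k, hk⟩ := hB
  let p : MvPolynomial (Fin (N + 1)) ℂ := H * X 0 ^ (d - 1 - d')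
  have hp : p ≠ 0 := mul_ne_zero hH (pow_ne_zero _ (X_ne_zero 0))
  have hphom : p.IsHomogeneous (d - 1) := by
    convert hHhom.mul (isHomogeneous_X_pow (R := ℂ) (0 : Fin (N + 1)) (d - 1 - d')) using 1
    omega
  have hpXhom (j) : (p * X j).IsHomogeneous d := by
    convert hphom.mul (isHomogeneous_X ℂ j) using 1
    omega
  have hint (j) : IsIntegral (Algebra.adjoin ℂ (Set.range F)) (p * X j) := by
    refine isIntegral_adjoin_of_X_pow_mul_mem hFhom (hpXhom j) (k := k) fun i ↦ ?_
    rw [← mul_assoc, ← mul_assoc, mul_assoc (_ * H)]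
    exact Ideal.mul_mem_right _ _ (hk i)
  have hF0 : F 0 ≠ 0 := hFind.ne_zero 0
  have halg : Algebra.IsAlgebraic (Algebra.adjoin ℂ (Set.range F)) (MvPolynomial (Fin (N + 1)) ℂ) :=
    isAlgebraic_adjoin_of_isAlgebraic_mul_X hd hFhom hF0 hp fun j ↦ (hint j).isAlgebraic
  have hFalg : AlgebraicIndependent ℂ F :=
    (Algebra.IsAlgebraic.isTranscendenceBasis_of_le_trdeg_of_finite ℂ F
      (by simp [MvPolynomial.trdeg_of_isDomain])).1
  have := isIntegrallyClosed_adjoin hFalg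
  refine ⟨p, hphom, exists_eq_mul_of_mul_X_mem_span hFind hp fun j ↦
    mem_span_of_mem_adjoin_s10 hd hFhom (hpXhom j) ?_⟩
  obtain ⟨a, ha⟩ := mem_range_algebraMap_of_forall_ringHom_eq (hint j) fun σ τ hσ hτ hA ↦ by
    have hqF : q * F 0 ≠ 0 := mul_ne_zero hq hF0
    refine ringHom_eq_of_forall_eval_eq (F := F) (p := q * F 0) ?_ σ τ
      (fun c ↦ hA (algebraMap ℂ _ c)) ((map_ne_zero_iff σ hσ).mpr hqF)
      ((map_ne_zero_iff τ hτ).mpr hqF) fun i ↦ ?_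
    · intro x y hx hy hxy
      rw [map_mul] at hx hy
      obtain ⟨c, -, rfl⟩ := hinj x y (left_ne_zero_of_mul hx) (left_ne_zero_of_mul hy)
        ⟨1, one_ne_zero, by simpa using hxy⟩
      have hsmul {f : MvPolynomial (Fin (N + 1)) ℂ} (hf : f.IsHomogeneous d) :
          eval (c • x) f = c ^ d * eval x f := by
        simpa only [aeval_eq_eval, coe_aeval_eq_eval] using aeval_smul_of_isHomogeneous hf c x
      have hc : c ^ d = 1 := by
        have := hxy 0
        rw [hsmul (hFhom 0)] at this
        exact (mul_eq_right₀ (right_ne_zero_of_mul hx)).mp this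
      rw [hsmul (hpXhom j), hc, one_mul]
    · exact hA ⟨F i, Algebra.subset_adjoin ⟨i, rfl⟩⟩
  rw [← ha]
  exact a.2
end

section
/- Let Y ⊂ ℙᴺ be an irreducible hypersurface of degree d > 1 with dual variety X = Y* ⊂ ℙᴺ*, and let Z ⊂ ℙᴺ* be the closure of the image of the polar map φ given by the partial derivatives of the defining polynomial. Then X is strictly contained in Z; in particular dim Z ≥ dim X + 1. -/
/-!
STATEMENT 11: For an irreducible hypersurface `Y = {F = 0} ⊂ ℙᴺ` of degree `d > 1`,
the dual variety `X = Y*` (closure of the image of `Y` under the Gauss/polar map) is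
strictly contained in the closure `Z` of the image of the polar map `φ` on all of `ℙᴺ`;
in particular `dim Z ≥ dim X + 1`.
Everything is phrased via affine cones: `Z` and `X` are the Zariski closures in the dual
affine space of the gradient image of `ℂ^{N+1}`, resp. of the affine cone of `Y`;
dimension is Krull dimension computed by chains of irreducible Zariski-closed subsets.
-/

open MvPolynomial

/-- Zariski closure in affine space. -/
def zcl {σ : Type*} (S : Set (σ → ℂ)) : Set (σ → ℂ) :=
  {x | ∀ p : MvPolynomial σ ℂ, (∀ y ∈ S, eval y p = 0) → eval x p = 0}

/-- Zariski-closed subsets of affine space. -/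
def ZClosed {σ : Type*} (S : Set (σ → ℂ)) : Prop := zcl S = S

/-- Irreducibility with respect to the Zariski topology. -/
def ZIrr {σ : Type*} (S : Set (σ → ℂ)) : Prop :=
  S.Nonempty ∧ ∀ C₁ C₂ : Set (σ → ℂ), ZClosed C₁ → ZClosed C₂ →
    S ⊆ C₁ ∪ C₂ → (S ⊆ C₁ ∨ S ⊆ C₂)

/-- Dimension of an affine algebraic set: the Krull dimension of the poset of
irreducible Zariski-closed subsets contained in it. -/
noncomputable def adim {σ : Type*} (S : Set (σ → ℂ)) : WithBot ℕ∞ :=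
  Order.krullDim {T : Set (σ → ℂ) // ZIrr T ∧ ZClosed T ∧ T ⊆ S}

/-- The (affine) polar map of a hypersurface `{F = 0}`: the gradient of `F`. -/
noncomputable def polarMap {N : ℕ} (F : MvPolynomial (Fin (N + 1)) ℂ)
    (x : Fin (N + 1) → ℂ) : Fin (N + 1) → ℂ :=
  fun i => eval x (pderiv i F)

/-- In characteristic zero every field extension is formally smooth. -/
theorem formallySmooth_of_charZero (K L : Type*) [Field K] [Field L] [Algebra K L] [CharZero K] :
    Algebra.FormallySmooth K L := by
  obtain ⟨s, hs⟩ := exists_isTranscendenceBasis K L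
  have := hs.isAlgebraic_field
  exact .of_algebraicIndependent_of_isSeparable hs.1

/-- In characteristic zero, a derivation of a domain with values in an extension field `L`
extends to `L`. -/
theorem Derivation.exists_extension_of_charZero {k R L : Type*} [CommRing k] [CommRing R]
    [IsDomain R] [Field L] [CharZero L] [Algebra k R] [Algebra k L] [Algebra R L]
    [IsScalarTower k R L] (hinj : Function.Injective (algebraMap R L)) (D : Derivation k R L) :
    ∃ E : Derivation k L L, ∀ r, E (algebraMap R L r) = D r := by
  have : FaithfulSMul R L := (faithfulSMul_iff_algebraMap_injective R L).mpr hinj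
  let := FractionRing.liftAlgebra R L
  have : CharZero (FractionRing R) :=
    (algebraMap (FractionRing R) L).charZero_iff (algebraMap (FractionRing R) L).injective |>.mpr
      inferInstance
  have := formallySmooth_of_charZero (FractionRing R) L
  have : Algebra.FormallySmooth R (FractionRing R) := .of_isLocalization (nonZeroDivisors R)
  have : Algebra.FormallySmooth R L := .comp _ (FractionRing R) _
  have hker : LinearMap.ker (KaehlerDifferential.mapBaseChange k R L) = ⊥ := by
    refine LinearMap.ker_eq_bot'.mpr fun m hm ↦ ?_
    obtain ⟨x, rfl⟩ := (Algebra.H1Cotangent.exact_δ_mapBaseChange k R L m).mp hm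
    rw [Subsingleton.elim x 0, map_zero]
  obtain ⟨g, hg⟩ := LinearMap.exists_leftInverse_of_injective _ hker
  refine ⟨((D.liftKaehlerDifferential.liftBaseChange L) ∘ₗ g).compDer
    (KaehlerDifferential.D k L), fun r ↦ ?_⟩
  have h := LinearMap.congr_fun hg (1 ⊗ₜ[R] KaehlerDifferential.D k R r)
  simp only [LinearMap.comp_apply, KaehlerDifferential.mapBaseChange_tmul, one_smul,
    KaehlerDifferential.map_D, LinearMap.id_apply] at h
  simp [h]

/-- Some partial derivative of a homogeneous polynomial of positive degree in characteristic zero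
is not divisible by the polynomial. -/
theorem MvPolynomial.IsHomogeneous.exists_not_dvd_pderiv {k σ : Type*} [Field k] [CharZero k]
    [Fintype σ] {d : ℕ} (hd : d ≠ 0) {F : MvPolynomial σ k} (hF : F ≠ 0)
    (hhom : F.IsHomogeneous d) : ∃ i, ¬ F ∣ pderiv i F := by
  by_contra! h
  have hzero (i : σ) : pderiv i F = 0 := by
    by_contra hi
    have hle := totalDegree_le_of_dvd_of_isDomain (h i) hi
    rw [hhom.totalDegree hF, hhom.pderiv.totalDegree hi] at hle
    omega
  have := hhom.sum_X_mul_pderiv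
  simp [hzero, hd, hF, eq_comm] at this

/-- Partial derivatives of polynomials commute. -/
theorem MvPolynomial.pderiv_pderiv_comm {R σ : Type*} [CommRing R] (i j : σ)
    (p : MvPolynomial σ R) : pderiv i (pderiv j p) = pderiv j (pderiv i p) := by
  classical
  have h : ⁅pderiv (R := R) i, pderiv j⁆ = 0 := derivation_ext fun l ↦ by
    rw [Derivation.commutator_apply]
    simp [pderiv_X, Pi.single_apply, apply_ite]
  rw [← sub_eq_zero, ← Derivation.commutator_apply, h, Derivation.zero_apply]

/-- The chain rule for derivations of a polynomial ring. -/
theorem MvPolynomial.derivation_eq_sum_pderiv_smul {R σ M : Type*} [CommRing R] [Fintype σ]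
    [AddCommGroup M] [Module R M] [Module (MvPolynomial σ R) M]
    [IsScalarTower R (MvPolynomial σ R) M]
    (D : Derivation R (MvPolynomial σ R) M) (p : MvPolynomial σ R) :
    D p = ∑ i, pderiv i p • D (X i) := by
  classical
  have hsum (q : MvPolynomial σ R) :
      (∑ i, (LinearMap.toSpanSingleton _ M (D (X i))).compDer (pderiv i)) q =
        ∑ i, pderiv i q • D (X i) := by
    rw [← Derivation.coeFnAddMonoidHom_apply, map_sum, Finset.sum_apply]
    rfl
  have h : D = ∑ i, (LinearMap.toSpanSingleton _ M (D (X i))).compDer (pderiv i) :=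
    derivation_ext fun l ↦ by simp [hsum, pderiv_X, Pi.single_apply, ite_smul]
  rw [← hsum, ← h]

/-- There is a polynomial relation between the partial derivatives of `F` which holds along the
hypersurface `F = 0` but does not hold identically. -/
theorem exists_dvd_aeval_pderiv_ne_zero {k σ : Type*} [Field k] [CharZero k] [Fintype σ]
    {d : ℕ} (hd : 1 < d) {F : MvPolynomial σ k} (hirr : Irreducible F)
    (hhom : F.IsHomogeneous d) :
    ∃ p : MvPolynomial σ k, F ∣ aeval (fun j ↦ pderiv j F) p ∧
      aeval (fun j ↦ pderiv j F) p ≠ 0 := by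
  by_contra! hcon
  have hprime : (Ideal.span {F}).IsPrime :=
    (Ideal.span_singleton_prime hirr.ne_zero).mpr hirr.prime
  let L := FractionRing (MvPolynomial σ k ⧸ Ideal.span {F})
  have hmap (q : MvPolynomial σ k) : algebraMap (MvPolynomial σ k) L q = 0 ↔ F ∣ q := by
    rw [IsScalarTower.algebraMap_apply _ (MvPolynomial σ k ⧸ Ideal.span {F}) L,
      FaithfulSMul.algebraMap_eq_zero_iff, Ideal.Quotient.algebraMap_eq,
      Ideal.Quotient.eq_zero_iff_mem, Ideal.mem_span_singleton]
  have : CharZero L := charZero_of_injective_algebraMap (algebraMap k L).injective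
  let S := (aeval (R := k) fun j ↦ pderiv j F).range
  have hinj : Function.Injective (algebraMap S L) := by
    refine (injective_iff_map_eq_zero _).mpr ?_
    rintro ⟨_, p, rfl⟩ hp
    exact Subtype.ext (hcon p ((hmap _).mp hp))
  obtain ⟨i, hi⟩ := hhom.exists_not_dvd_pderiv (by omega) hirr.ne_zero
  obtain ⟨E, hE⟩ := Derivation.exists_extension_of_charZero hinj
    (((Algebra.linearMap (MvPolynomial σ k) L).compDer (pderiv i)).compAlgebraMap S)
  have hE' (j : σ) : E (algebraMap _ L (pderiv j F)) = algebraMap _ L (pderiv i (pderiv j F)) :=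
    hE ⟨pderiv j F, X j, by simp⟩
  have hF0 : algebraMap _ L F = 0 := (hmap F).mpr dvd_rfl
  have hEF : ∑ j, algebraMap (MvPolynomial σ k) L (pderiv j F) *
      E (algebraMap (MvPolynomial σ k) L (X j)) = 0 := by
    have h := derivation_eq_sum_pderiv_smul (E.compAlgebraMap (MvPolynomial σ k)) F
    simp only [Derivation.compAlgebraMap_apply, hF0, map_zero, Algebra.smul_def] at h
    exact h.symm
  have euler := congr(E (algebraMap _ L $(hhom.sum_X_mul_pderiv)))
  have euler' := congr(algebraMap _ L $((hhom.pderiv (i := i)).sum_X_mul_pderiv))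
  simp only [map_sum, map_mul, Derivation.leibniz, smul_eq_mul, hE', pderiv_pderiv_comm i,
    map_nsmul, hF0, smul_zero, map_zero, Finset.sum_add_distrib, hEF, add_zero] at euler euler'
  rw [euler, eq_comm, smul_eq_zero, hmap] at euler'
  exact euler'.elim (by omega) hi

theorem eval_aeval_eq {R σ τ : Type*} [CommSemiring R] (f : τ → MvPolynomial σ R)
    (p : MvPolynomial τ R) (x : σ → R) :
    eval x (aeval f p) = eval (fun i ↦ eval x (f i)) p := by
  induction p using MvPolynomial.induction_on <;> simp_all

theorem zcl_mono {σ : Type*} {S T : Set (σ → ℂ)} (h : S ⊆ T) : zcl S ⊆ zcl T :=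
  fun _ hx p hp ↦ hx p fun y hy ↦ hp y (h hy)

theorem subset_zcl {σ : Type*} (S : Set (σ → ℂ)) : S ⊆ zcl S :=
  fun _ hx _ hp ↦ hp _ hx

theorem zClosed_zcl {σ : Type*} (S : Set (σ → ℂ)) : ZClosed (zcl S) :=
  (subset_zcl _).antisymm' fun _ hx p hp ↦ hx p fun _ hy ↦ hy p hp

/-- The closure of the image of a polynomial map from affine space is irreducible. -/
theorem zIrr_zcl_range {σ τ : Type*} (f : τ → MvPolynomial σ ℂ) :
    ZIrr (zcl (Set.range fun x i ↦ eval x (f i))) := by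
  refine ⟨(Set.range_nonempty _).mono (subset_zcl _), fun C₁ C₂ h₁ h₂ hsub ↦ ?_⟩
  have hle {C : Set (τ → ℂ)} (hC : ZClosed C)
      (h : ∀ p : MvPolynomial τ ℂ, (∀ y ∈ C, eval y p = 0) → aeval f p = 0) :
      zcl (Set.range fun x i ↦ eval x (f i)) ⊆ C := by
    rw [← hC]
    intro x hx p hp
    refine hx p ?_
    rintro _ ⟨y, rfl⟩
    rw [← eval_aeval_eq, h p hp, map_zero]
  by_contra! hcon
  have hp₁ := mt (hle h₁) hcon.1
  have hp₂ := mt (hle h₂) hcon.2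
  push Not at hp₁ hp₂
  obtain ⟨p₁, hp₁, hne₁⟩ := hp₁
  obtain ⟨p₂, hp₂, hne₂⟩ := hp₂
  refine mul_ne_zero hne₁ hne₂ (MvPolynomial.funext fun x ↦ ?_)
  rw [map_mul, eval_aeval_eq, eval_aeval_eq, map_zero, mul_eq_zero]
  exact (hsub (subset_zcl _ ⟨x, rfl⟩)).imp (hp₁ _) (hp₂ _)

theorem adim_add_one_le {σ : Type*} {S T : Set (σ → ℂ)} (hT : ZIrr T) (hT' : ZClosed T)
    (h : S ⊂ T) : adim S + 1 ≤ adim T := by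
  unfold adim
  obtain _ | _ := isEmpty_or_nonempty {U : Set (σ → ℂ) // ZIrr U ∧ ZClosed U ∧ U ⊆ S}
  · simp [Order.krullDim_eq_bot]
  rw [← Order.krullDim_WithTop]
  let g : WithTop {U : Set (σ → ℂ) // ZIrr U ∧ ZClosed U ∧ U ⊆ S} →
      {U : Set (σ → ℂ) // ZIrr U ∧ ZClosed U ∧ U ⊆ T} :=
    WithTop.recTopCoe ⟨T, hT, hT', subset_rfl⟩
      fun U ↦ ⟨U.1, U.2.1, U.2.2.1, U.2.2.2.trans h.subset⟩
  refine Order.krullDim_le_of_strictMono g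
    (WithTop.strictMono_iff.mpr ⟨fun U V hUV ↦ hUV, fun U ↦ ?_⟩)
  exact U.2.2.2.trans_ssubset h

theorem stmt11 {N d : ℕ} (hd : 1 < d)
    (F : MvPolynomial (Fin (N + 1)) ℂ)
    (hFirr : Irreducible F) (hFhom : F.IsHomogeneous d) :
    zcl (polarMap F '' {x | eval x F = 0}) ⊆ zcl (Set.range (polarMap F)) ∧
    zcl (polarMap F '' {x | eval x F = 0}) ≠ zcl (Set.range (polarMap F)) ∧
    adim (zcl (polarMap F '' {x | eval x F = 0})) + 1
      ≤ adim (zcl (Set.range (polarMap F))) := by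
  have hsub : zcl (polarMap F '' {x | eval x F = 0}) ⊆ zcl (Set.range (polarMap F)) :=
    zcl_mono (Set.image_subset_range _ _)
  have hne : zcl (polarMap F '' {x | eval x F = 0}) ≠ zcl (Set.range (polarMap F)) := by
    intro heq
    obtain ⟨p, hdvd, hp⟩ := exists_dvd_aeval_pderiv_ne_zero hd hFirr hFhom
    refine hp (MvPolynomial.funext fun x ↦ ?_)
    have hx : polarMap F x ∈ zcl (polarMap F '' {x | eval x F = 0}) :=
      heq ▸ subset_zcl _ ⟨x, rfl⟩
    rw [eval_aeval_eq, map_zero]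
    refine hx p ?_
    rintro _ ⟨y, hy, rfl⟩
    obtain ⟨q, hq⟩ := hdvd
    have := congr(eval y $hq)
    rwa [eval_aeval_eq, map_mul, hy, zero_mul] at this
  exact ⟨hsub, hne, adim_add_one_le (zIrr_zcl_range fun i ↦ pderiv i F) (zClosed_zcl _)
    (hsub.ssubset_of_ne hne)⟩
end

section
/- Let V ⊂ ℙW be an irreducible smooth projective variety, Y = SV its secant variety, and suppose V is an irreducible component of Sing(Y). Then aut(Ŷ) = aut(V̂) as Lie subalgebras of gl(W), and consequently aut¹(Ŷ) = aut¹(V̂). -/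
/-!
STATEMENT 15: Let `V ⊂ ℙW` be an irreducible smooth projective variety and `Y = SV` its
secant variety; suppose `V` is an irreducible component of `Sing Y`.  Then
`aut(Ŷ) = aut(V̂)` as subsets of `gl(W)`, and consequently `aut¹(Ŷ) = aut¹(V̂)`.
Everything is phrased via affine cones in `W = ℂⁿ` with the Zariski topology expressed
through polynomials: `ztang` is the Zariski tangent space, smoothness of a point of an
irreducible algebraic set of (affine) dimension `d+1` means the tangent space has
dimension `d+1`, and `aut` of a cone is the space of linear endomorphisms sending each
smooth point into the tangent space there.
-/

open MvPolynomial

/-- Zariski tangent space at a point of an affine algebraic set. -/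
def ztang {n : ℕ} (S : Set (Fin n → ℂ)) (y : Fin n → ℂ) : Set (Fin n → ℂ) :=
  {u | ∀ p : MvPolynomial (Fin n) ℂ, (∀ x ∈ S, eval x p = 0) →
    (∑ i, u i * eval y (pderiv i p)) = 0}

/-- The singular locus of an affine algebraic set of dimension `e`:
points where the Zariski tangent space does not have the expected dimension. -/
def singLoc {n : ℕ} (S : Set (Fin n → ℂ)) (e : ℕ) : Set (Fin n → ℂ) :=
  {y ∈ S | Module.rank ℂ (Submodule.span ℂ (ztang S y)) ≠ (e : Cardinal)}

/-- The affine cone over the secant variety of the projective variety with cone `V`. -/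
def secantCone {n : ℕ} (V : Set (Fin n → ℂ)) : Set (Fin n → ℂ) :=
  zcl {w | ∃ v₁ ∈ V, ∃ v₂ ∈ V, ∃ a b : ℂ, w = a • v₁ + b • v₂}

theorem mem_zcl_of_mem {σ : Type*} {S : Set (σ → ℂ)} {x : σ → ℂ} (h : x ∈ S) : x ∈ zcl S :=
  fun _ hp => hp x h

theorem zcl_subset_of_zClosed {σ : Type*} {S C : Set (σ → ℂ)} (hC : ZClosed C) (h : S ⊆ C) :
    zcl S ⊆ C := by
  intro x hx
  rw [← hC]
  exact fun p hp => hx p fun y hy => hp y (h hy)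

theorem zClosed_iff {σ : Type*} {S : Set (σ → ℂ)} :
    ZClosed S ↔ ∀ x, x ∉ S → ∃ p : MvPolynomial σ ℂ, (∀ y ∈ S, eval y p = 0) ∧ eval x p ≠ 0 := by
  constructor
  · intro h x hx
    rw [← h] at hx
    simpa [zcl] using hx
  · intro h
    refine Set.Subset.antisymm (fun x hx => ?_) fun x => mem_zcl_of_mem
    by_contra hn
    obtain ⟨p, hp, hpx⟩ := h x hn
    exact hpx (hx p hp)

theorem zClosed_zeros {σ : Type*} (p : MvPolynomial σ ℂ) : ZClosed {x | eval x p = 0} :=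
  zClosed_iff.2 fun _ hx => ⟨p, fun _ hy => hy, hx⟩

theorem zIrr_iff {σ : Type*} {S : Set (σ → ℂ)} :
    ZIrr S ↔ S.Nonempty ∧ ∀ p q : MvPolynomial σ ℂ, (∀ x ∈ S, eval x p = 0 ∨ eval x q = 0) →
      (∀ x ∈ S, eval x p = 0) ∨ ∀ x ∈ S, eval x q = 0 := by
  refine and_congr_right fun _ => ⟨fun h p q hpq =>
    h _ _ (zClosed_zeros p) (zClosed_zeros q) hpq, fun h C₁ C₂ h₁ h₂ hS => ?_⟩
  by_contra! hn
  obtain ⟨⟨x, hx, hx₁⟩, y, hy, hy₂⟩ := hn.imp Set.not_subset.1 Set.not_subset.1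
  obtain ⟨p, hp, hpx⟩ := zClosed_iff.1 h₁ x hx₁
  obtain ⟨q, hq, hqy⟩ := zClosed_iff.1 h₂ y hy₂
  rcases h p q fun z hz => (hS hz).imp (hp z) (hq z) with h | h
  exacts [hpx (h x hx), hqy (h y hy)]

theorem ZIrr.zcl {σ : Type*} {S : Set (σ → ℂ)} (h : ZIrr S) : ZIrr (zcl S) :=
  ⟨h.1.mono fun _ => mem_zcl_of_mem, fun C₁ C₂ h₁ h₂ hS =>
    (h.2 C₁ C₂ h₁ h₂ fun _ hx => hS (mem_zcl_of_mem hx)).imp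
      (zcl_subset_of_zClosed h₁) (zcl_subset_of_zClosed h₂)⟩

/-- The Zariski tangent space as a submodule. -/
def ztangSubmodule {n : ℕ} (S : Set (Fin n → ℂ)) (y : Fin n → ℂ) :
    Submodule ℂ (Fin n → ℂ) where
  carrier := ztang S y
  add_mem' {u v} hu hv p hp := by
    simp only [Pi.add_apply, add_mul, Finset.sum_add_distrib, hu p hp, hv p hp, add_zero]
  zero_mem' p _ := by simp
  smul_mem' c u hu p hp := by
    simp only [Pi.smul_apply, smul_eq_mul, mul_assoc, ← Finset.mul_sum, hu p hp, mul_zero]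

theorem rank_span_ztang {n : ℕ} (S : Set (Fin n → ℂ)) (y : Fin n → ℂ) :
    Module.rank ℂ (Submodule.span ℂ (ztang S y)) =
      (Module.finrank ℂ (ztangSubmodule S y) : Cardinal) := by
  rw [Module.finrank_eq_rank]
  exact congrArg (fun W : Submodule ℂ (Fin n → ℂ) => Module.rank ℂ W)
    (Submodule.span_eq (ztangSubmodule S y))

theorem mem_singLoc {n : ℕ} {S : Set (Fin n → ℂ)} {e : ℕ} {y : Fin n → ℂ} :
    y ∈ singLoc S e ↔ y ∈ S ∧ Module.finrank ℂ (ztangSubmodule S y) ≠ e := by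
  simp only [singLoc, Set.mem_sep_iff, rank_span_ztang, ne_eq, Nat.cast_inj]

open Matrix in
/-- Upper semicontinuity of the dimension of the Zariski tangent space. -/
theorem exists_eval_ne_zero_finrank_ztangSubmodule_le {n : ℕ} (S : Set (Fin n → ℂ))
    (y₀ : Fin n → ℂ) :
    ∃ f : MvPolynomial (Fin n) ℂ, eval y₀ f ≠ 0 ∧ ∀ y, eval y f ≠ 0 →
      Module.finrank ℂ (ztangSubmodule S y) ≤ Module.finrank ℂ (ztangSubmodule S y₀) := by
  classical
  let G : Submodule ℂ (Fin n → ℂ) :=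
    { carrier := {v | ∃ p : MvPolynomial (Fin n) ℂ, (∀ x ∈ S, eval x p = 0) ∧
        v = fun i => eval y₀ (pderiv i p)}
      add_mem' := by
        rintro _ _ ⟨p, hp, rfl⟩ ⟨q, hq, rfl⟩
        exact ⟨p + q, fun x hx => by simp [hp x hx, hq x hx], by ext; simp⟩
      zero_mem' := ⟨0, by simp, by ext; simp⟩
      smul_mem' := by
        rintro c _ ⟨p, hp, rfl⟩
        exact ⟨C c * p, fun x hx => by simp [hp x hx], by ext; simp⟩ }
  let m := Module.finrank ℂ G
  let b : Module.Basis (Fin m) ℂ G := Module.finBasis ℂ G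
  choose p hp hpb using fun i => (b i).2
  let M : Matrix (Fin m) (Fin n) (MvPolynomial (Fin n) ℂ) := of fun i j => pderiv j (p i)
  have hker : ∀ y, ztangSubmodule S y ≤ LinearMap.ker (M.map (eval y)).mulVecLin := by
    intro y u hu
    rw [LinearMap.mem_ker]
    ext i
    have := hu (p i) (hp i)
    simpa [M, mulVec, dotProduct, mul_comm] using this
  have hker₀ : LinearMap.ker (M.map (eval y₀)).mulVecLin ≤ ztangSubmodule S y₀ := by
    intro u hu q hq
    let φ : G →ₗ[ℂ] ℂ := (Fintype.linearCombination ℂ u).comp G.subtype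
    have key : φ = 0 := b.ext fun i => by
      have := congrFun (LinearMap.mem_ker.1 hu) i
      simpa [φ, M, mulVec, dotProduct, Fintype.linearCombination_apply, hpb] using this
    simpa [φ, Fintype.linearCombination_apply, mul_comm] using
      LinearMap.congr_fun key ⟨_, q, hq, rfl⟩
  have hli : LinearIndependent ℂ (M.map (eval y₀)).row := by
    have h : (M.map (eval y₀)).row = G.subtype ∘ b := by
      ext i j
      simp [M, hpb]
    rw [h]
    exact b.linearIndependent.map' G.subtype (by simp)
  have hsurj : Function.Surjective (M.map (eval y₀)).mulVecLin := by
    rw [← LinearMap.range_eq_top]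
    apply Submodule.eq_top_of_finrank_eq
    have := hli.rank_matrix
    simpa [Matrix.rank] using this
  obtain ⟨B, hB⟩ := Matrix.mulVec_surjective_iff_exists_right_inverse.1 hsurj
  refine ⟨(M * B.map (C (σ := Fin n))).det, ?_, fun y hy => ?_⟩
  · have : (M.map (eval y₀) * B) = (M * B.map (C (σ := Fin n))).map (eval y₀) := by
      rw [Matrix.map_mul]; congr; ext; simp
    rw [RingHom.map_det, RingHom.mapMatrix_apply, ← this, hB]
    simp
  · have h1 : (M.map (eval y) * B) = (M * B.map (C (σ := Fin n))).map (eval y) := by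
      rw [Matrix.map_mul]; congr; ext; simp
    rw [RingHom.map_det, RingHom.mapMatrix_apply, ← h1] at hy
    have hs : LinearMap.range (M.map (eval y)).mulVecLin = ⊤ := by
      rw [LinearMap.range_eq_top]
      refine Matrix.mulVec_surjective_iff_exists_right_inverse.2
        ⟨B * (M.map (eval y) * B)⁻¹, ?_⟩
      rw [← Matrix.mul_assoc, Matrix.mul_nonsing_inv _ hy.isUnit]
    have e1 := LinearMap.finrank_range_add_finrank_ker (M.map (eval y)).mulVecLin
    have e2 := LinearMap.finrank_range_add_finrank_ker (M.map (eval y₀)).mulVecLin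
    rw [hs] at e1
    rw [LinearMap.range_eq_top.2 hsurj] at e2
    have := Submodule.finrank_mono (hker y)
    have := Submodule.finrank_mono hker₀
    omega

theorem zClosed_singLoc {n : ℕ} {S : Set (Fin n → ℂ)} (hS : ZClosed S) {e : ℕ}
    (h : ∀ y ∈ S, e ≤ Module.finrank ℂ (ztangSubmodule S y)) : ZClosed (singLoc S e) := by
  refine zClosed_iff.2 fun x hx => ?_
  by_cases hxS : x ∈ S
  · obtain ⟨f, hf, hle⟩ := exists_eval_ne_zero_finrank_ztangSubmodule_le S x
    refine ⟨f, fun y hy => ?_, hf⟩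
    by_contra hfy
    rw [mem_singLoc] at hx hy
    have := hle y hfy
    have := h y hy.1
    have := h x hxS
    have := hy.2
    by_cases h' : Module.finrank ℂ (ztangSubmodule S x) = e
    · omega
    · exact hx ⟨hxS, h'⟩
  · obtain ⟨p, hp, hpx⟩ := zClosed_iff.1 hS x hxS
    exact ⟨p, fun y hy => hp y hy.1, hpx⟩

/-- In characteristic zero, the partial derivative along a member of a transcendence basis
extends to a derivation of the whole field. -/
theorem IsTranscendenceBasis.exists_derivation {F K ι : Type*} [Field F] [CharZero F] [Field K]
    [Algebra F K] [DecidableEq ι] {x : ι → K} (hx : IsTranscendenceBasis F x) (i : ι) :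
    ∃ δ : Derivation F K K, ∀ j, δ (x j) = if j = i then 1 else 0 := by
  let f : MvPolynomial ι F →ₐ[F] K := aeval x
  let : Algebra (MvPolynomial ι F) K := f.toRingHom.toAlgebra
  have hmap : ∀ p, algebraMap (MvPolynomial ι F) K p = f p := fun _ => rfl
  have : IsScalarTower F (MvPolynomial ι F) K := .of_algebraMap_eq fun r => by
    rw [hmap, algebraMap_eq, algHom_C]
  have : FaithfulSMul (MvPolynomial ι F) K :=
    (faithfulSMul_iff_algebraMap_injective _ _).2 hx.1
  let : Algebra (FractionRing (MvPolynomial ι F)) K := FractionRing.liftAlgebra _ _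
  have : IsScalarTower (MvPolynomial ι F) (FractionRing (MvPolynomial ι F)) K :=
    FractionRing.isScalarTower_liftAlgebra _ _
  have : Algebra.IsAlgebraic (MvPolynomial ι F) K := by
    have := hx.isAlgebraic
    exact Algebra.IsAlgebraic.of_ringHom_of_comp_eq
      (hx.1.aevalEquiv : MvPolynomial ι F →+* Algebra.adjoin F (Set.range x)) (RingHom.id K)
      hx.1.aevalEquiv.surjective Function.injective_id (by ext <;> simp [hmap, f])
  have : Algebra.IsAlgebraic (FractionRing (MvPolynomial ι F)) K :=
    (IsFractionRing.comap_isAlgebraic_iff (A := MvPolynomial ι F)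
      (K := FractionRing (MvPolynomial ι F)) (C := K)).1 inferInstance
  have : CharZero (FractionRing (MvPolynomial ι F)) :=
    charZero_of_injective_algebraMap (algebraMap F _).injective
  have : Algebra.FormallyEtale (MvPolynomial ι F) (FractionRing (MvPolynomial ι F)) :=
    .of_isLocalization (nonZeroDivisors _)
  have : Algebra.FormallyEtale (FractionRing (MvPolynomial ι F)) K :=
    .of_isSeparable _ _
  have : Algebra.FormallyEtale (MvPolynomial ι F) K :=
    .comp _ (FractionRing (MvPolynomial ι F)) _
  have hb := KaehlerDifferential.isBaseChange_of_formallyEtale F (MvPolynomial ι F) K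
  let d : Derivation F (MvPolynomial ι F) K :=
    mkDerivation F fun j => if j = i then 1 else 0
  refine ⟨(hb.lift d.liftKaehlerDifferential).compDer (KaehlerDifferential.D F K), fun j => ?_⟩
  have hj : x j = algebraMap (MvPolynomial ι F) K (X j) := (aeval_X x j).symm
  have := hb.lift_eq d.liftKaehlerDifferential
    (KaehlerDifferential.D F (MvPolynomial ι F) (X j))
  rw [KaehlerDifferential.map_D, ← hj] at this
  refine this.trans ?_
  simp [d, mkDerivation_X]

theorem AlgebraicIndependent.exists_derivation {F K ι : Type*} [Field F] [CharZero F] [Field K]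
    [Algebra F K] [DecidableEq ι] {x : ι → K} (hx : AlgebraicIndependent F x) (i : ι) :
    ∃ δ : Derivation F K K, ∀ j, δ (x j) = if j = i then 1 else 0 := by
  classical
  obtain ⟨t, hst, ht⟩ := exists_isTranscendenceBasis_superset
    (AlgebraicIndependent.to_subtype_range hx)
  obtain ⟨δ, hδ⟩ := ht.exists_derivation ⟨x i, hst ⟨i, rfl⟩⟩
  have hinj : Function.Injective x := AlgebraicIndependent.injective hx
  exact ⟨δ, fun j => by simpa [hinj.eq_iff] using hδ ⟨x j, hst ⟨j, rfl⟩⟩⟩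

theorem Derivation.apply_aeval_mvPolynomial {F K σ : Type*} [CommRing F] [CommRing K]
    [Algebra F K] [Fintype σ] (δ : Derivation F K K) (z : σ → K) (p : MvPolynomial σ F) :
    δ (aeval z p) = ∑ j, δ (z j) * aeval z (pderiv j p) := by
  classical
  induction p using MvPolynomial.induction_on with
  | C a => simp
  | add p q hp hq => simp [hp, hq, mul_add, Finset.sum_add_distrib]
  | mul_X p i hp =>
    simp only [map_mul, aeval_X, Derivation.leibniz, hp, smul_eq_mul, pderiv_X, map_add,
      mul_add, Finset.sum_add_distrib, Finset.mul_sum]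
    congr 1
    · simp [Pi.single_apply, apply_ite (aeval z), mul_comm]
    · exact Finset.sum_congr rfl fun _ _ => by ring

/-- Vector fields dual to the differentials of functions that are algebraically independent modulo
a prime ideal, and tangent to that ideal. -/
theorem exists_dual_vectorFields {F : Type*} [Field F] [CharZero F] {n d : ℕ}
    (I : Ideal (MvPolynomial (Fin n) F)) [I.IsPrime] (q : Fin d → MvPolynomial (Fin n) F)
    (hq : AlgebraicIndependent F fun i => Ideal.Quotient.mk I (q i)) :
    ∃ (h : MvPolynomial (Fin n) F) (U : Fin d → Fin n → MvPolynomial (Fin n) F), h ∉ I ∧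
      (∀ i, ∀ p ∈ I, ∑ j, U i j * pderiv j p ∈ I) ∧
      ∀ i k, (∑ j, U i j * pderiv j (q k)) - (if k = i then h else 0) ∈ I := by
  classical
  let A := MvPolynomial (Fin n) F ⧸ I
  let K := FractionRing A
  let z : Fin n → K := fun j => algebraMap A K (Ideal.Quotient.mk I (X j))
  have hz : ∀ p, aeval z p = algebraMap A K (Ideal.Quotient.mk I p) := fun p => by
    have : (aeval z : MvPolynomial (Fin n) F →ₐ[F] K) =
      (IsScalarTower.toAlgHom F A K).comp (Ideal.Quotient.mkₐ F I) := by
      ext j; simp [z]; rfl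
    exact DFunLike.congr_fun this p
  have hinj : Function.Injective (algebraMap A K) := IsFractionRing.injective A K
  have hqK : AlgebraicIndependent F fun i => aeval z (q i) := by
    simp only [hz]
    exact hq.map' (f := IsScalarTower.toAlgHom F A K) hinj
  choose δ hδ using hqK.exists_derivation
  obtain ⟨b, hb⟩ := IsLocalization.exist_integer_multiples_of_finset (nonZeroDivisors A)
    (Finset.univ.image fun ij : Fin d × Fin n => δ ij.1 (z ij.2))
  obtain ⟨h, hh⟩ := Ideal.Quotient.mk_surjective (b : A)
  have hU : ∀ i j, ∃ u : MvPolynomial (Fin n) F, aeval z u = aeval z h * δ i (z j) := by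
    intro i j
    obtain ⟨a, ha⟩ := hb (δ i (z j)) (Finset.mem_image.2 ⟨(i, j), Finset.mem_univ _, rfl⟩)
    obtain ⟨u, rfl⟩ := Ideal.Quotient.mk_surjective a
    refine ⟨u, ?_⟩
    rw [hz, hz, hh, ha, Algebra.smul_def]
  choose U hU using hU
  have hmem : ∀ p, p ∈ I ↔ aeval z p = 0 := fun p => by
    rw [hz, map_eq_zero_iff _ hinj, Ideal.Quotient.eq_zero_iff_mem]
  have hsum : ∀ i p, aeval z (∑ j, U i j * pderiv j p) = aeval z h * δ i (aeval z p) := by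
    intro i p
    rw [Derivation.apply_aeval_mvPolynomial, Finset.mul_sum]
    simp [hU, mul_assoc]
  refine ⟨h, U, ?_, fun i p hp => ?_, fun i k => ?_⟩
  · rw [← Ideal.Quotient.eq_zero_iff_mem, hh]
    exact nonZeroDivisors.coe_ne_zero b
  · rw [hmem, hsum, (hmem p).1 hp, map_zero, mul_zero]
  · rw [hmem, map_sub, hsum, hδ]
    split_ifs <;> simp

theorem mem_vanishingIdeal_iff_eval {σ : Type*} {S : Set (σ → ℂ)} {p : MvPolynomial σ ℂ} :
    p ∈ vanishingIdeal ℂ S ↔ ∀ x ∈ S, eval x p = 0 := by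
  simp [mem_vanishingIdeal_iff, aeval_eq_eval]

theorem ZIrr.isPrime_vanishingIdeal {σ : Type*} {S : Set (σ → ℂ)} (h : ZIrr S) :
    (vanishingIdeal ℂ S).IsPrime := by
  obtain ⟨⟨x, hx⟩, h⟩ := zIrr_iff.1 h
  refine ⟨fun htop => ?_, fun {p q} hpq => ?_⟩
  · have := mem_vanishingIdeal_iff_eval.1 ((Ideal.eq_top_iff_one _).1 htop) x hx
    simp at this
  · simp only [mem_vanishingIdeal_iff_eval] at *
    exact h p q fun x hx => by simpa using hpq x hx

theorem ZIrr.card_le_finrank_ztangSubmodule {n d : ℕ} {S : Set (Fin n → ℂ)} (h : ZIrr S)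
    (q : Fin d → MvPolynomial (Fin n) ℂ)
    (hq : AlgebraicIndependent ℂ fun i => Ideal.Quotient.mk (vanishingIdeal ℂ S) (q i))
    {y : Fin n → ℂ} (hy : y ∈ S) : d ≤ Module.finrank ℂ (ztangSubmodule S y) := by
  have := h.isPrime_vanishingIdeal
  obtain ⟨g, U, hg, hU, hUq⟩ := exists_dual_vectorFields _ q hq
  obtain ⟨f, hf, hle⟩ := exists_eval_ne_zero_finrank_ztangSubmodule_le S y
  have hfg : f * g ∉ vanishingIdeal ℂ S := fun hmem =>
    (this.mem_or_mem hmem).elim (fun h => hf (mem_vanishingIdeal_iff_eval.1 h y hy)) hg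
  simp only [mem_vanishingIdeal_iff_eval, not_forall, map_mul, mul_ne_zero_iff] at hfg
  obtain ⟨w, hw, hne⟩ := hfg
  have hfw : eval w f ≠ 0 := hne.1
  have hgw : eval w g ≠ 0 := hne.2
  refine le_trans ?_ (hle w hfw)
  let u : Fin d → ztangSubmodule S w := fun i => ⟨fun j => eval w (U i j), fun p hp => by
    simpa using mem_vanishingIdeal_iff_eval.1 (hU i p (mem_vanishingIdeal_iff_eval.2 hp)) w hw⟩
  have hu : LinearIndependent ℂ u := by
    rw [Fintype.linearIndependent_iff]
    intro c hc k
    have hc' : ∀ j, ∑ i, c i * eval w (U i j) = 0 := fun j => by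
      simpa [u] using congrFun (congrArg Subtype.val hc) j
    have hk : ∀ i, ∑ j, eval w (U i j) * eval w (pderiv j (q k)) =
        if k = i then eval w g else 0 := fun i => by
      have := mem_vanishingIdeal_iff_eval.1 (hUq i k) w hw
      rw [map_sub, sub_eq_zero] at this
      simpa [apply_ite (eval w)] using this
    have : ∑ i, c i * ∑ j, eval w (U i j) * eval w (pderiv j (q k)) = 0 := by
      simp only [Finset.mul_sum]
      rw [Finset.sum_comm]
      refine Finset.sum_eq_zero fun j _ => ?_
      simp only [← mul_assoc, ← Finset.sum_mul, hc' j, zero_mul]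
    simpa [hk, hgw] using this
  simpa using hu.fintype_card_le_finrank

/-- A nonzero function vanishing on a subvariety is algebraically independent of functions
that are algebraically independent on the subvariety. -/
theorem AlgebraicIndependent.cons_of_map_eq_zero {F A B : Type*} [Field F] [CommRing A] [IsDomain A]
    [CommRing B] [Algebra F A] [Algebra F B] (φ : A →ₐ[F] B) {k : ℕ} {x : Fin k → A}
    (hx : AlgebraicIndependent F (φ ∘ x)) {a : A} (ha : a ≠ 0) (hφ : φ a = 0) :
    AlgebraicIndependent F (Fin.cons a x : Fin (k + 1) → A) := by
  have hx' : AlgebraicIndependent F x := AlgebraicIndependent.of_comp φ hx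
  have htr : Transcendental (Algebra.adjoin F (Set.range x)) a := by
    intro halg
    obtain ⟨t, -, r, hr, hat⟩ :=
      halg.exists_nonzero_eq_adjoin_mul (mem_nonZeroDivisors_of_ne_zero ha)
    obtain ⟨p, rfl⟩ := (AlgebraicIndependent.aevalEquiv hx').surjective r
    have h0 : φ (aeval x p) = 0 := by
      have := congrArg φ hat
      rwa [map_mul, hφ, zero_mul, hx'.algebraMap_aevalEquiv, eq_comm] at this
    have hp : p = 0 := hx (by rw [map_zero, ← h0, ← AlgHom.comp_apply, comp_aeval]; rfl)
    exact hr (by rw [hp, map_zero])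
  have := (AlgebraicIndependent.option_iff.2 ⟨hx', htr⟩).comp _ (finSuccEquiv k).injective
  convert this using 1
  ext i
  refine Fin.cases ?_ (fun i => ?_) i <;> simp

theorem AlgebraicIndependent.of_vanishingIdeal_le {σ ι : Type*} {S T : Set (σ → ℂ)} (h : T ⊆ S)
    {q : ι → MvPolynomial σ ℂ}
    (hq : AlgebraicIndependent ℂ fun i => Ideal.Quotient.mk (vanishingIdeal ℂ T) (q i)) :
    AlgebraicIndependent ℂ fun i => Ideal.Quotient.mk (vanishingIdeal ℂ S) (q i) :=
  AlgebraicIndependent.of_comp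
    (Ideal.Quotient.factorₐ ℂ (vanishingIdeal_anti_mono h)) hq

theorem ZIrr.exists_algebraicIndependent_cons {σ : Type*} {S T : Set (σ → ℂ)} (hS : ZIrr S)
    (hT : ZClosed T) (h : T ⊂ S) {k : ℕ} (q : Fin k → MvPolynomial σ ℂ)
    (hq : AlgebraicIndependent ℂ fun i => Ideal.Quotient.mk (vanishingIdeal ℂ T) (q i)) :
    ∃ q' : Fin (k + 1) → MvPolynomial σ ℂ,
      AlgebraicIndependent ℂ fun i => Ideal.Quotient.mk (vanishingIdeal ℂ S) (q' i) := by
  have := hS.isPrime_vanishingIdeal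
  obtain ⟨x, hxS, hxT⟩ := Set.exists_of_ssubset h
  obtain ⟨p, hp, hpx⟩ := zClosed_iff.1 hT x hxT
  refine ⟨Fin.cons p q, ?_⟩
  have := AlgebraicIndependent.cons_of_map_eq_zero
    (Ideal.Quotient.factorₐ ℂ (vanishingIdeal_anti_mono (k := ℂ) h.1))
    (x := fun i => Ideal.Quotient.mk (vanishingIdeal ℂ S) (q i)) hq
    (a := Ideal.Quotient.mk (vanishingIdeal ℂ S) p)
    (fun h0 => hpx (mem_vanishingIdeal_iff_eval.1 (Ideal.Quotient.eq_zero_iff_mem.1 h0) x hxS))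
    (Ideal.Quotient.eq_zero_iff_mem.2 (mem_vanishingIdeal_iff_eval.2 hp))
  have hcons : (fun i => Ideal.Quotient.mk (vanishingIdeal ℂ S)
      ((Fin.cons p q : Fin (k + 1) → MvPolynomial σ ℂ) i)) = Fin.cons
        (Ideal.Quotient.mk (vanishingIdeal ℂ S) p) fun i =>
          Ideal.Quotient.mk (vanishingIdeal ℂ S) (q i) := by
    ext i
    refine Fin.cases ?_ (fun i => ?_) i <;> simp
  rw [hcons]
  exact this

theorem exists_algebraicIndependent_of_le_adim {σ : Type*} {S : Set (σ → ℂ)} {d : ℕ}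
    (h : (d : ℕ∞) ≤ adim S) : ∃ q : Fin d → MvPolynomial σ ℂ,
      AlgebraicIndependent ℂ fun i => Ideal.Quotient.mk (vanishingIdeal ℂ S) (q i) := by
  obtain ⟨l, rfl⟩ := Order.le_krullDim_iff.1 h
  suffices ∀ k (hk : k < l.length + 1), ∃ q : Fin k → MvPolynomial σ ℂ,
      AlgebraicIndependent ℂ fun i =>
        Ideal.Quotient.mk (vanishingIdeal ℂ (l ⟨k, hk⟩).1) (q i) by
    obtain ⟨q, hq⟩ := this l.length (Nat.lt_succ_self _)
    exact ⟨q, AlgebraicIndependent.of_vanishingIdeal_le (l _).2.2.2 hq⟩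
  intro k
  induction k with
  | zero =>
    intro hk
    have := (l ⟨0, hk⟩).2.1.isPrime_vanishingIdeal
    exact ⟨Fin.elim0, algebraicIndependent_empty_type_iff.2 (algebraMap ℂ _).injective⟩
  | succ k ih =>
    intro hk
    obtain ⟨q, hq⟩ := ih (Nat.lt_of_succ_lt hk)
    exact (l ⟨k + 1, hk⟩).2.1.exists_algebraicIndependent_cons (l ⟨k, _⟩).2.2.1
      (l.strictMono (Fin.mk_lt_mk.2 k.lt_succ_self)) q hq

theorem ZIrr.le_finrank_ztangSubmodule {n d : ℕ} {S : Set (Fin n → ℂ)} (hS : ZIrr S)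
    (h : (d : ℕ∞) ≤ adim S) {y : Fin n → ℂ} (hy : y ∈ S) :
    d ≤ Module.finrank ℂ (ztangSubmodule S y) :=
  let ⟨q, hq⟩ := exists_algebraicIndependent_of_le_adim h
  hS.card_le_finrank_ztangSubmodule q hq hy

theorem hasDerivAt_eval_mvPolynomial {n : ℕ} {γ : ℂ → Fin n → ℂ} {γ' : Fin n → ℂ} {t : ℂ}
    (h : HasDerivAt γ γ' t) (p : MvPolynomial (Fin n) ℂ) :
    HasDerivAt (fun s => eval (γ s) p) (∑ i, γ' i * eval (γ t) (pderiv i p)) t := by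
  classical
  induction p using MvPolynomial.induction_on with
  | C a => simpa using hasDerivAt_const t a
  | add p q hp hq =>
    simp only [map_add, mul_add, Finset.sum_add_distrib]
    exact hp.add hq
  | mul_X p i hp =>
    simp only [map_mul, eval_X]
    refine (hp.mul (hasDerivAt_pi.1 h i)).congr_deriv ?_
    symm
    simp only [Derivation.leibniz, pderiv_X, smul_eq_mul, map_add, map_mul, eval_X, mul_add,
      Finset.sum_add_distrib, Finset.sum_mul]
    rw [add_comm]
    congr 1
    · exact Finset.sum_congr rfl fun _ _ => by ring
    · simp [Pi.single_apply, apply_ite (eval (γ t)), mul_comm]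

/-- The coordinates of a linear endomorphism, as linear forms. -/
noncomputable def linearForms {n : ℕ} (g : (Fin n → ℂ) →ₗ[ℂ] (Fin n → ℂ)) (i : Fin n) :
    MvPolynomial (Fin n) ℂ :=
  ∑ j, C (g (Pi.single j 1) i) * X j

theorem eval_linearForms {n : ℕ} (g : (Fin n → ℂ) →ₗ[ℂ] (Fin n → ℂ)) (i : Fin n)
    (y : Fin n → ℂ) : eval y (linearForms g i) = g y i := by
  conv_rhs => rw [← Finset.univ_sum_single y]
  have : ∀ j, Pi.single j (y j) = y j • (Pi.single j 1 : Fin n → ℂ) := fun j => by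
    rw [← Pi.single_smul, smul_eq_mul, mul_one]
  simp [linearForms, this, mul_comm]

/-- The derivative of a polynomial along a linear vector field. -/
noncomputable def lieDer {n : ℕ} (g : (Fin n → ℂ) →ₗ[ℂ] (Fin n → ℂ))
    (p : MvPolynomial (Fin n) ℂ) : MvPolynomial (Fin n) ℂ :=
  ∑ i, linearForms g i * pderiv i p

theorem eval_lieDer {n : ℕ} (g : (Fin n → ℂ) →ₗ[ℂ] (Fin n → ℂ)) (p : MvPolynomial (Fin n) ℂ)
    (y : Fin n → ℂ) : eval y (lieDer g p) = ∑ i, g y i * eval y (pderiv i p) := by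
  simp [lieDer, eval_linearForms]

theorem eval_bind₁_linearForms_add_C {n : ℕ} (g : (Fin n → ℂ) →ₗ[ℂ] (Fin n → ℂ))
    (b : Fin n → ℂ) (p : MvPolynomial (Fin n) ℂ) (y : Fin n → ℂ) :
    eval y (bind₁ (fun i => linearForms g i + C (b i)) p) = eval (g y + b) p := by
  induction p using MvPolynomial.induction_on with
  | C a => simp
  | add p q hp hq => simp [hp, hq]
  | mul_X p i hp => simp [hp, eval_linearForms]

theorem ZClosed.setOf_forall_eval_eq_zero {n : ℕ} {ι : Sort*}
    (A : ι → (Fin n → ℂ) →ₗ[ℂ] (Fin n → ℂ)) (b : ι → Fin n → ℂ) (p : MvPolynomial (Fin n) ℂ) :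
    ZClosed {v | ∀ t, eval (A t v + b t) p = 0} := by
  refine zClosed_iff.2 fun v hv => ?_
  obtain ⟨t, ht⟩ := not_forall.1 hv
  refine ⟨bind₁ (fun i => linearForms (A t) i + C (b t i)) p, fun y hy => ?_, ?_⟩
  · rw [eval_bind₁_linearForms_add_C]; exact hy t
  · rwa [eval_bind₁_linearForms_add_C]

/-- An affine map from one algebraic set to another acts on tangent vectors. -/
theorem map_mem_ztang {n : ℕ} {A : (Fin n → ℂ) →ₗ[ℂ] (Fin n → ℂ)} {b : Fin n → ℂ}
    {S T : Set (Fin n → ℂ)} (hA : ∀ x ∈ S, A x + b ∈ T) {u y : Fin n → ℂ} (hu : u ∈ ztang S y) :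
    A u ∈ ztang T (A y + b) := by
  intro p hp
  have h1 : HasDerivAt (fun s : ℂ => y + s • u) u 0 := by
    simpa using ((hasDerivAt_id (0 : ℂ)).smul_const u).const_add y
  have h2 : HasDerivAt (fun s : ℂ => A y + s • A u + b) (A u) 0 := by
    simpa using (((hasDerivAt_id (0 : ℂ)).smul_const (A u)).const_add (A y)).add_const b
  have e1 := hasDerivAt_eval_mvPolynomial h1
    (bind₁ (fun i => linearForms A i + C (b i)) p)
  have e2 := hasDerivAt_eval_mvPolynomial h2 p
  simp only [eval_bind₁_linearForms_add_C, map_add, map_smul, zero_smul, add_zero] at e1 e2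
  rw [e2.unique e1]
  exact hu _ fun x hx => by rw [eval_bind₁_linearForms_add_C]; exact hp _ (hA x hx)

theorem finrank_ztangSubmodule_le_map {n : ℕ} {A B : (Fin n → ℂ) →ₗ[ℂ] (Fin n → ℂ)}
    (hBA : ∀ x, B (A x) = x) {S : Set (Fin n → ℂ)} (hA : ∀ x ∈ S, A x ∈ S) (y : Fin n → ℂ) :
    Module.finrank ℂ (ztangSubmodule S y) ≤ Module.finrank ℂ (ztangSubmodule S (A y)) := by
  refine LinearMap.finrank_le_finrank_of_injective
    (f := A.restrict (p := ztangSubmodule S y) (q := ztangSubmodule S (A y))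
      fun u hu => add_zero (A y) ▸
        map_mem_ztang (b := 0) (fun x hx => (add_zero (A x)).symm ▸ hA x hx) hu) fun u v huv => ?_
  have : A u = A v := congrArg Subtype.val huv
  exact Subtype.ext (by rw [← hBA u, this, hBA])

theorem map_mem_singLoc {n : ℕ} {A B : (Fin n → ℂ) →ₗ[ℂ] (Fin n → ℂ)}
    (hBA : ∀ x, B (A x) = x) (hAB : ∀ x, A (B x) = x) {S : Set (Fin n → ℂ)}
    (hA : ∀ x ∈ S, A x ∈ S) (hB : ∀ x ∈ S, B x ∈ S) {e : ℕ} {y : Fin n → ℂ}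
    (hy : y ∈ singLoc S e) : A y ∈ singLoc S e := by
  rw [mem_singLoc] at *
  have h1 := finrank_ztangSubmodule_le_map hBA hA y
  have h2 := finrank_ztangSubmodule_le_map hAB hB (A y)
  rw [hBA] at h2
  exact ⟨hA y hy.1, le_antisymm h1 h2 ▸ hy.2⟩

/-- The flow of a linear vector field. -/
noncomputable def linearFlow {n : ℕ} (g : (Fin n → ℂ) →ₗ[ℂ] (Fin n → ℂ)) (t : ℂ) :
    (Fin n → ℂ) →ₗ[ℂ] (Fin n → ℂ) :=
  (NormedSpace.exp (LinearMap.toContinuousLinearMap (t • g)) :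
    (Fin n → ℂ) →L[ℂ] (Fin n → ℂ)).toLinearMap

theorem linearFlow_zero {n : ℕ} (g : (Fin n → ℂ) →ₗ[ℂ] (Fin n → ℂ)) (v : Fin n → ℂ) :
    linearFlow g 0 v = v := by
  rw [linearFlow, zero_smul, map_zero, NormedSpace.exp_zero]
  rfl

theorem linearFlow_neg_linearFlow {n : ℕ} (g : (Fin n → ℂ) →ₗ[ℂ] (Fin n → ℂ)) (t : ℂ)
    (v : Fin n → ℂ) : linearFlow g (-t) (linearFlow g t v) = v := by
  let : NormedAlgebra ℚ ((Fin n → ℂ) →L[ℂ] (Fin n → ℂ)) := .restrictScalars ℚ ℂ _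
  have := NormedSpace.exp_add_of_commute (x := LinearMap.toContinuousLinearMap (-t • g))
    (y := LinearMap.toContinuousLinearMap (t • g)) (ContinuousLinearMap.ext fun x => by simp)
  rw [← map_add, ← add_smul, neg_add_cancel, zero_smul, map_zero, NormedSpace.exp_zero] at this
  exact (DFunLike.congr_fun this v).symm

theorem hasDerivAt_linearFlow {n : ℕ} (g : (Fin n → ℂ) →ₗ[ℂ] (Fin n → ℂ)) (v : Fin n → ℂ)
    (t : ℂ) : HasDerivAt (fun s => linearFlow g s v) (g (linearFlow g t v)) t := by
  have h := hasDerivAt_exp_smul_const' (LinearMap.toContinuousLinearMap g) t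
  have h' := (h.clm_apply (hasDerivAt_const t v)).congr_deriv
    (g' := g (linearFlow g t v)) (by rw [map_zero, add_zero, linearFlow, map_smul]; rfl)
  simp only [linearFlow, map_smul] at h' ⊢
  exact h'

theorem hasDerivAt_eval_linearFlow {n : ℕ} (g : (Fin n → ℂ) →ₗ[ℂ] (Fin n → ℂ))
    (p : MvPolynomial (Fin n) ℂ) (v : Fin n → ℂ) (t : ℂ) :
    HasDerivAt (fun s => eval (linearFlow g s v) p) (eval (linearFlow g t v) (lieDer g p)) t := by
  rw [eval_lieDer]
  exact hasDerivAt_eval_mvPolynomial (hasDerivAt_linearFlow g v t) p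

theorem differentiable_eval_linearFlow {n : ℕ} (g : (Fin n → ℂ) →ₗ[ℂ] (Fin n → ℂ))
    (p : MvPolynomial (Fin n) ℂ) (v : Fin n → ℂ) :
    Differentiable ℂ fun s => eval (linearFlow g s v) p :=
  fun t => (hasDerivAt_eval_linearFlow g p v t).differentiableAt

theorem linearFlow_mem {n : ℕ} {g : (Fin n → ℂ) →ₗ[ℂ] (Fin n → ℂ)} {S : Set (Fin n → ℂ)}
    (hS : ZClosed S) (h : ∀ p : MvPolynomial (Fin n) ℂ, (∀ x ∈ S, eval x p = 0) →
      ∀ x ∈ S, eval x (lieDer g p) = 0) (t : ℂ) {y : Fin n → ℂ} (hy : y ∈ S) :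
    linearFlow g t y ∈ S := by
  rw [← hS]
  intro p hp
  have hiter : ∀ k, ∀ x ∈ S, eval x ((lieDer g)^[k] p) = 0 := fun k => by
    induction k with
    | zero => exact hp
    | succ k ih => rw [Function.iterate_succ_apply']; exact h _ ih
  have hderiv : ∀ k, iteratedDeriv k (fun s => eval (linearFlow g s y) p) =
      fun s => eval (linearFlow g s y) ((lieDer g)^[k] p) := fun k => by
    induction k with
    | zero => simp
    | succ k ih =>
      rw [iteratedDeriv_succ, ih, Function.iterate_succ_apply']
      exact funext fun s => (hasDerivAt_eval_linearFlow g _ y s).deriv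
  have := Complex.taylorSeries_eq_of_entire (differentiable_eval_linearFlow g p y) 0 t
  rw [← this]
  simp [hderiv, linearFlow_zero, hiter _ y hy]

theorem ZIrr.linearFlow {n : ℕ} (g : (Fin n → ℂ) →ₗ[ℂ] (Fin n → ℂ)) {S : Set (Fin n → ℂ)}
    (hS : ZIrr S) : ZIrr {w | ∃ t, ∃ v ∈ S, w = linearFlow g t v} := by
  have hcl : ∀ p : MvPolynomial (Fin n) ℂ,
      ZClosed {v | ∀ t, eval (_root_.linearFlow g t v) p = 0} := fun p => by
    simpa using ZClosed.setOf_forall_eval_eq_zero (_root_.linearFlow g) (fun _ => 0) p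
  obtain ⟨⟨v, hv⟩, hS⟩ := hS
  refine zIrr_iff.2 ⟨⟨_, 0, v, hv, rfl⟩, fun p q hpq => ?_⟩
  refine (hS _ _ (hcl p) (hcl q) fun v hv => ?_).imp ?_ ?_
  · have := AnalyticOnNhd.eq_zero_or_eq_zero_of_mul_eq_zero (U := Set.univ)
      ((differentiable_eval_linearFlow g p v).differentiableOn.analyticOnNhd isOpen_univ)
      ((differentiable_eval_linearFlow g q v).differentiableOn.analyticOnNhd isOpen_univ)
      (fun t _ => mul_eq_zero.2 (hpq _ ⟨t, v, hv, rfl⟩)) isPreconnected_univ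
    simpa using this
  all_goals
    rintro h _ ⟨t, v, hv, rfl⟩
    exact h hv t

theorem ZIrr.add {n : ℕ} {V : Set (Fin n → ℂ)} (hV : ZIrr V) :
    ZIrr {w | ∃ x ∈ V, ∃ y ∈ V, w = x + y} := by
  have hcl : ∀ p : MvPolynomial (Fin n) ℂ,
      ZClosed {y | ∀ x : V, eval (y + x.1) p = 0} := fun p => by
    simpa using ZClosed.setOf_forall_eval_eq_zero (fun _ : V => LinearMap.id) (fun x => x.1) p
  obtain ⟨v, hv⟩ := hV.1
  refine zIrr_iff.2 ⟨⟨_, v, hv, v, hv, rfl⟩, fun p q hpq => ?_⟩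
  refine (hV.2 _ _ (hcl p) (hcl q) fun y hy => ?_).imp ?_ ?_
  · have hcl' : ∀ p : MvPolynomial (Fin n) ℂ, ZClosed {x | eval (x + y) p = 0} := fun p => by
      simpa using ZClosed.setOf_forall_eval_eq_zero (fun _ : Unit => LinearMap.id) (fun _ => y) p
    have := hV.2 _ _ (hcl' p) (hcl' q) fun x hx => hpq _ ⟨x, hx, y, hy, rfl⟩
    refine this.imp (fun h x => ?_) fun h x => ?_ <;> rw [add_comm] <;> exact h x.2
  all_goals
    rintro h _ ⟨x, hx, y, hy, rfl⟩
    exact h hx ⟨y, hy⟩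

theorem secantCone_eq {n : ℕ} {V : Set (Fin n → ℂ)} (hV : ∀ c : ℂ, ∀ v ∈ V, c • v ∈ V) :
    secantCone V = zcl {w | ∃ x ∈ V, ∃ y ∈ V, w = x + y} := by
  refine congrArg zcl (Set.Subset.antisymm ?_ ?_)
  · rintro _ ⟨x, hx, y, hy, a, b, rfl⟩
    exact ⟨_, hV a x hx, _, hV b y hy, rfl⟩
  · rintro _ ⟨x, hx, y, hy, rfl⟩
    exact ⟨x, hx, y, hy, 1, 1, by simp⟩

theorem add_mem_secantCone {n : ℕ} {V : Set (Fin n → ℂ)} {x y : Fin n → ℂ} (hx : x ∈ V)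
    (hy : y ∈ V) : x + y ∈ secantCone V :=
  mem_zcl_of_mem ⟨x, hx, y, hy, 1, 1, by simp⟩

theorem mem_ztang_iff_eval_lieDer {n : ℕ} {g : (Fin n → ℂ) →ₗ[ℂ] (Fin n → ℂ)}
    {S : Set (Fin n → ℂ)} {y : Fin n → ℂ} : g y ∈ ztang S y ↔
      ∀ p : MvPolynomial (Fin n) ℂ, (∀ x ∈ S, eval x p = 0) → eval y (lieDer g p) = 0 := by
  simp only [eval_lieDer]
  rfl

/-- Infinitesimal automorphisms of a cone are infinitesimal automorphisms of its secant variety. -/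
theorem mem_ztang_secantCone {n : ℕ} {V : Set (Fin n → ℂ)}
    (hV : ∀ c : ℂ, ∀ v ∈ V, c • v ∈ V) {g : (Fin n → ℂ) →ₗ[ℂ] (Fin n → ℂ)}
    (hg : ∀ v ∈ V, v ≠ 0 → g v ∈ ztang V v) {y : Fin n → ℂ} (hy : y ∈ secantCone V) :
    g y ∈ ztang (secantCone V) y := by
  have hg' : ∀ v ∈ V, g v ∈ ztangSubmodule V v := fun v hv => by
    by_cases h0 : v = 0
    · rw [h0, map_zero]; exact zero_mem _
    · exact hg v hv h0
  have hadd : ∀ x ∈ V, ∀ y ∈ V, g x ∈ ztangSubmodule (secantCone V) (x + y) := fun x hx y hy =>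
    map_mem_ztang (A := LinearMap.id) (b := y) (fun z hz => add_mem_secantCone hz hy) (hg' x hx)
  refine mem_ztang_iff_eval_lieDer.2 fun p hp => ?_
  rw [secantCone_eq hV] at hy
  refine hy _ ?_
  rintro _ ⟨v, hv, w, hw, rfl⟩
  refine mem_ztang_iff_eval_lieDer.1 ?_ p hp
  have hw' := hadd w hw v hv
  rw [add_comm] at hw'
  rw [map_add]
  exact add_mem (hadd v hv w hw) hw'

/-- A linear vector field tangent to a variety at its smooth points preserves the irreducible
components of the singular locus. -/
theorem mem_ztang_of_maximal_singLoc {n e : ℕ} {V Y : Set (Fin n → ℂ)} (hY : ZIrr Y)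
    (hYcl : ZClosed Y) (hYe : (e : ℕ∞) ≤ adim Y) (hne : ¬ Y ⊆ singLoc Y e) (hV : ZIrr V)
    (hVsing : V ⊆ singLoc Y e)
    (hVmax : ∀ T : Set (Fin n → ℂ), ZIrr T → ZClosed T → V ⊆ T → T ⊆ singLoc Y e → T = V)
    {g : (Fin n → ℂ) →ₗ[ℂ] (Fin n → ℂ)}
    (hg : ∀ y ∈ Y, y ∉ singLoc Y e → g y ∈ ztang Y y) {v : Fin n → ℂ} (hv : v ∈ V) :
    g v ∈ ztang V v := by
  have hsing : ZClosed (singLoc Y e) :=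
    zClosed_singLoc hYcl fun y hy => hY.le_finrank_ztangSubmodule hYe hy
  have hD : ∀ p : MvPolynomial (Fin n) ℂ, (∀ x ∈ Y, eval x p = 0) →
      ∀ x ∈ Y, eval x (lieDer g p) = 0 := fun p hp =>
    (hY.2 _ _ hsing (zClosed_zeros (lieDer g p)) fun y hy => or_iff_not_imp_left.2 fun h =>
      mem_ztang_iff_eval_lieDer.1 (hg y hy h) p hp).resolve_left hne
  have hflow : ∀ t, ∀ y ∈ Y, linearFlow g t y ∈ Y := fun t y hy => linearFlow_mem hYcl hD t hy
  have hsub : zcl {w | ∃ t, ∃ v ∈ V, w = linearFlow g t v} ⊆ singLoc Y e := by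
    refine zcl_subset_of_zClosed hsing ?_
    rintro _ ⟨t, v, hv, rfl⟩
    refine map_mem_singLoc (linearFlow_neg_linearFlow g t) (fun x => ?_) (hflow t) (hflow (-t))
      (hVsing hv)
    simpa using linearFlow_neg_linearFlow g (-t) x
  have hT := hVmax _ (hV.linearFlow g).zcl (zClosed_zcl _)
    (fun v hv => mem_zcl_of_mem ⟨0, v, hv, (linearFlow_zero g v).symm⟩) hsub
  refine mem_ztang_iff_eval_lieDer.2 fun p hp => ?_
  have h0 : (fun s => eval (linearFlow g s v) p) = fun _ => 0 := funext fun s =>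
    hp _ (hT ▸ mem_zcl_of_mem ⟨s, v, hv, rfl⟩)
  have h1 := hasDerivAt_eval_linearFlow g p v 0
  rw [h0, linearFlow_zero] at h1
  exact h1.unique (hasDerivAt_const _ _)

theorem exists_ne_zero_of_adim_pos {n d : ℕ} {V : Set (Fin n → ℂ)}
    (h : adim V = ((d + 1 : ℕ) : ℕ∞)) : ∃ v ∈ V, v ≠ 0 := by
  by_contra! h0
  have : Subsingleton {T : Set (Fin n → ℂ) // ZIrr T ∧ ZClosed T ∧ T ⊆ V} := by
    suffices ∀ T : Set (Fin n → ℂ), ZIrr T ∧ ZClosed T ∧ T ⊆ V → T = {0} from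
      ⟨fun a b => Subtype.ext ((this _ a.2).trans (this _ b.2).symm)⟩
    exact fun T hT => hT.1.1.subset_singleton_iff.1 fun x hx => h0 x (hT.2.2 hx)
  have h1 := Order.krullDim_nonpos_of_subsingleton
    (α := {T : Set (Fin n → ℂ) // ZIrr T ∧ ZClosed T ∧ T ⊆ V})
  rw [adim] at h
  rw [h] at h1
  norm_cast at h1

theorem aut_secantCone_iff {n : ℕ} {V : Set (Fin n → ℂ)}
    (hVcone : ∀ (c : ℂ), ∀ v ∈ V, c • v ∈ V) (hVirr : ZIrr V)
    {dV : ℕ} (hdV : adim V = ((dV + 1 : ℕ) : ℕ∞))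
    (hVsmooth : ∀ v ∈ V, v ≠ 0 →
      Module.rank ℂ (Submodule.span ℂ (ztang V v)) = ((dV + 1 : ℕ) : Cardinal))
    {dY : ℕ} (hdY : adim (secantCone V) = ((dY + 1 : ℕ) : ℕ∞))
    (hVsing : V ⊆ singLoc (secantCone V) (dY + 1))
    (hVmax : ∀ T : Set (Fin n → ℂ), ZIrr T → ZClosed T → V ⊆ T →
      T ⊆ singLoc (secantCone V) (dY + 1) → T = V) (g : (Fin n → ℂ) →ₗ[ℂ] (Fin n → ℂ)) :
    (∀ y ∈ secantCone V, y ∉ singLoc (secantCone V) (dY + 1) → g y ∈ ztang (secantCone V) y) ↔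
      ∀ v ∈ V, v ≠ 0 → g v ∈ ztang V v := by
  refine ⟨fun hg v hv _ => ?_, fun hg y hy _ => mem_ztang_secantCone hVcone hg hy⟩
  have hYirr : ZIrr (secantCone V) := secantCone_eq hVcone ▸ hVirr.add.zcl
  refine mem_ztang_of_maximal_singLoc hYirr (zClosed_zcl _) hdY.ge (fun hsub => ?_) hVirr hVsing
    hVmax hg hv
  have hYV := hVmax _ hYirr (zClosed_zcl _) (fun v hv => (hVsing hv).1) hsub
  obtain ⟨w, hw, hw0⟩ := exists_ne_zero_of_adim_pos hdV
  have hd : dV = dY := by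
    rw [hYV, hdV] at hdY
    simpa using hdY
  have h1 := (hVsing hw).2
  rw [hYV, hVsmooth w hw hw0, hd] at h1
  exact h1 rfl

theorem stmt15 {n : ℕ} (V : Set (Fin n → ℂ))
    (hVcone : ∀ (c : ℂ), ∀ v ∈ V, c • v ∈ V)
    (hVclosed : ZClosed V) (hVirr : ZIrr V)
    (dV : ℕ) (hdV : adim V = ((dV + 1 : ℕ) : ℕ∞))
    -- smoothness of V : every nonzero point of the cone V̂ is a smooth point
    (hVsmooth : ∀ v ∈ V, v ≠ 0 →
      Module.rank ℂ (Submodule.span ℂ (ztang V v)) = ((dV + 1 : ℕ) : Cardinal))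
    (dY : ℕ) (hdY : adim (secantCone V) = ((dY + 1 : ℕ) : ℕ∞))
    -- V is an irreducible component of Sing(SV)
    (hVsing : V ⊆ singLoc (secantCone V) (dY + 1))
    (hVmax : ∀ T : Set (Fin n → ℂ), ZIrr T → ZClosed T → V ⊆ T →
      T ⊆ singLoc (secantCone V) (dY + 1) → T = V) :
    -- aut(Ŷ) = aut(V̂)
    {g : (Fin n → ℂ) →ₗ[ℂ] (Fin n → ℂ) |
        ∀ y ∈ secantCone V, y ∉ singLoc (secantCone V) (dY + 1) →
          g y ∈ ztang (secantCone V) y}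
      = {g | ∀ v ∈ V, v ≠ 0 → g v ∈ ztang V v} ∧
    -- aut¹(Ŷ) = aut¹(V̂)
    {A : (Fin n → ℂ) →ₗ[ℂ] (Fin n → ℂ) →ₗ[ℂ] (Fin n → ℂ) |
        (∀ u w, A u w = A w u) ∧
        ∀ w, (∀ y ∈ secantCone V, y ∉ singLoc (secantCone V) (dY + 1) →
          A w y ∈ ztang (secantCone V) y)}
      = {A | (∀ u w, A u w = A w u) ∧
          ∀ w, (∀ v ∈ V, v ≠ 0 → A w v ∈ ztang V v)} := by
  have key := aut_secantCone_iff hVcone hVirr hdV hVsmooth hdY hVsing hVmax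
  exact ⟨Set.ext key, Set.ext fun A => and_congr_right fun _ => forall_congr' fun w => key (A w)⟩
end
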